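/- arXiv:1810.12003 — 4 statements merged into one kernel-verified Lean document; each statement's English description precedes it below -/
import Mathlib

section
/- (Buser's inequality on infinite graphs) Let G be an infinite weighted graph satisfying assumption (A), D_ω < ∞, and CD(∞,K) for some K ∈ ℝ. Then λ ≤ max{C₁ h(V)², C₂ √|K| · h(V)}, where λ is the bottom of the ℓ²-spectrum of −Δ, h(V) = inf over nonempty finite U ⊂ V of |∂U|/|U| is the Cheeger constant, and C₁, C₂ are constants depending only on D_ω. -/
open Real Filter Topology
open scoped BigOperators

/-- Graph Laplacian: `Δ f x = (1/m x) * Σ_y ω x y * (f y - f x)`. -/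
noncomputable def lapOp {V : Type*} (m : V → ℝ) (ω : V → V → ℝ) (f : V → ℝ) (x : V) : ℝ :=
  (1 / m x) * ∑' y, ω x y * (f y - f x)

/-- Carré du champ: `Γ(f,g)(x) = (1/(2 m x)) * Σ_y ω x y (f y - f x)(g y - g x)`. -/
noncomputable def gamOp {V : Type*} (m : V → ℝ) (ω : V → V → ℝ) (f g : V → ℝ) (x : V) : ℝ :=
  (1 / (2 * m x)) * ∑' y, ω x y * (f y - f x) * (g y - g x)

/-- Iterated carré du champ: `Γ₂(f) = (1/2) Δ Γ(f) - Γ(f, Δ f)`. -/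
noncomputable def gam2Op {V : Type*} (m : V → ℝ) (ω : V → V → ℝ) (f : V → ℝ) (x : V) : ℝ :=
  (1 / 2) * lapOp m ω (fun z => gamOp m ω f f z) x - gamOp m ω f (lapOp m ω f) x

/-- Local finiteness: every vertex has finitely many neighbours. -/
def LocallyFiniteGraph {V : Type*} (ω : V → V → ℝ) : Prop :=
  ∀ x, (Function.support fun y => ω x y).Finite

/-- Assumption (A): either the Laplacian is bounded on ℓ²_m
(equivalently `sup_x deg x / m x < ∞`), or the graph is complete with
non-degenerate measure. -/
def AssumptionA {V : Type*} (m : V → ℝ) (ω : V → V → ℝ) : Prop :=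
  (∃ C : ℝ, ∀ x, (∑' y, ω x y) / m x ≤ C) ∨
  ((∃ η : ℕ → V → ℝ,
      (∀ k, (Function.support (η k)).Finite) ∧
      (∀ k x, η k x ≤ η (k + 1) x) ∧
      (∀ x, Tendsto (fun k => η k x) atTop (𝓝 1)) ∧
      (∀ k : ℕ, 1 ≤ k → ∀ x, gamOp m ω (η k) (η k) x ≤ 1 / (k : ℝ))) ∧
    (∃ δ : ℝ, 0 < δ ∧ ∀ x, δ ≤ m x))

/-- Volume of a set of vertices. -/
noncomputable def volSet {V : Type*} (m : V → ℝ) (U : Set V) : ℝ :=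
  ∑' x, Set.indicator U m x

/-- Volume of the edge boundary `|∂U| = Σ_{x∈U, y∉U} ω x y`. -/
noncomputable def bdrySet {V : Type*} (ω : V → V → ℝ) (U : Set V) : ℝ :=
  ∑' x, Set.indicator U (fun x => ∑' y, Set.indicator Uᶜ (fun y => ω x y) y) x


namespace BuserAux

variable {V : Type*} {m : V → ℝ} {ω : V → V → ℝ}

lemma tsum_w {x : V} {W : Finset V} (hW : ∀ y, ω x y ≠ 0 → y ∈ W) (g : V → ℝ) :
    ∑' y, ω x y * g y = ∑ y ∈ W, ω x y * g y := by
  apply tsum_eq_sum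
  intro y hy
  have : ω x y = 0 := by
    by_contra h
    exact hy (hW y h)
  simp [this]

lemma lap_eq (hm : ∀ x, 0 < m x) {x : V} {W : Finset V} (hW : ∀ y, ω x y ≠ 0 → y ∈ W)
    (f : V → ℝ) : m x * lapOp m ω f x = ∑ y ∈ W, ω x y * (f y - f x) := by
  unfold lapOp
  rw [tsum_w hW (fun y => f y - f x)]
  have := (hm x).ne'
  field_simp

lemma gam_eq (hm : ∀ x, 0 < m x) {x : V} {W : Finset V} (hW : ∀ y, ω x y ≠ 0 → y ∈ W)
    (f g : V → ℝ) :
    2 * (m x * gamOp m ω f g x) = ∑ y ∈ W, ω x y * ((f y - f x) * (g y - g x)) := by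
  unfold gamOp
  simp_rw [mul_assoc (ω x _)]
  rw [tsum_w hW (fun y => (f y - f x) * (g y - g x))]
  have := (hm x).ne'
  field_simp

lemma exists_nb (hloc : LocallyFiniteGraph ω) (x : V) :
    ∃ W : Finset V, ∀ y, ω x y ≠ 0 → y ∈ W :=
  ⟨(hloc x).toFinset, fun y hy => by simpa using hy⟩

/-- a common finite set containing `s` and all its neighbours -/
lemma exists_nbs (hloc : LocallyFiniteGraph ω) (s : Finset V) :
    ∃ W : Finset V, s ⊆ W ∧ ∀ x ∈ s, ∀ y, ω x y ≠ 0 → y ∈ W := by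
  classical
  choose N hN using exists_nb hloc
  refine ⟨s ∪ s.biUnion N, Finset.subset_union_left, fun x hx y hy => ?_⟩
  exact Finset.mem_union_right _ (Finset.mem_biUnion.2 ⟨x, hx, hN x y hy⟩)

lemma lap_lin (hm : ∀ x, 0 < m x) (hloc : LocallyFiniteGraph ω) (a b : ℝ) (f g : V → ℝ) (x : V) :
    lapOp m ω (fun z => a * f z + b * g z) x = a * lapOp m ω f x + b * lapOp m ω g x := by
  obtain ⟨W, hW⟩ := exists_nb hloc x
  apply mul_left_cancel₀ (hm x).ne'
  rw [mul_add, mul_left_comm, mul_left_comm _ b, lap_eq hm hW, lap_eq hm hW, lap_eq hm hW,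
    Finset.mul_sum, Finset.mul_sum, ← Finset.sum_add_distrib]
  exact Finset.sum_congr rfl fun y _ => by ring

lemma lap_sq (hm : ∀ x, 0 < m x) (hloc : LocallyFiniteGraph ω) (f : V → ℝ) (x : V) :
    lapOp m ω (fun z => f z ^ 2) x = 2 * f x * lapOp m ω f x + 2 * gamOp m ω f f x := by
  obtain ⟨W, hW⟩ := exists_nb hloc x
  apply mul_left_cancel₀ (hm x).ne'
  have h1 := lap_eq hm hW f
  have h2 := gam_eq hm hW f f
  have h3 : m x * (2 * f x * lapOp m ω f x + 2 * gamOp m ω f f x)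
      = 2 * f x * (m x * lapOp m ω f x) + 2 * (m x * gamOp m ω f f x) := by ring
  rw [h3, h1, h2, lap_eq hm hW, Finset.mul_sum, ← Finset.sum_add_distrib]
  exact Finset.sum_congr rfl fun y _ => by ring

lemma gam_nonneg (hm : ∀ x, 0 < m x) (hnn : ∀ x y, 0 ≤ ω x y) (hloc : LocallyFiniteGraph ω)
    (f : V → ℝ) (x : V) : 0 ≤ gamOp m ω f f x := by
  obtain ⟨W, hW⟩ := exists_nb hloc x
  have h2 := gam_eq hm hW f f
  have : 0 ≤ ∑ y ∈ W, ω x y * ((f y - f x) * (f y - f x)) :=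
    Finset.sum_nonneg fun y _ => mul_nonneg (hnn x y) (mul_self_nonneg _)
  have h3 : 0 ≤ m x * gamOp m ω f f x := by linarith
  exact nonneg_of_mul_nonneg_right h3 (hm x)

lemma gam_step (hm : ∀ x, 0 < m x) (hnn : ∀ x y, 0 ≤ ω x y) (hloc : LocallyFiniteGraph ω)
    (τ : ℝ) (u v g : V → ℝ) (hu : ∀ x, v x - τ * g x = u x) (x : V) :
    gamOp m ω v v x - 2 * τ * gamOp m ω v g x ≤ gamOp m ω u u x := by
  obtain ⟨W, hW⟩ := exists_nb hloc x
  have h1 := gam_eq hm hW v v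
  have h2 := gam_eq hm hW v g
  have h3 := gam_eq hm hW u u
  have key : 2 * (m x * gamOp m ω v v x) - 2 * τ * (2 * (m x * gamOp m ω v g x))
      ≤ 2 * (m x * gamOp m ω u u x) := by
    rw [h1, h2, h3, Finset.mul_sum, ← Finset.sum_sub_distrib]
    apply Finset.sum_le_sum
    intro y _
    rw [← hu x, ← hu y]
    nlinarith [mul_nonneg (hnn x y) (sq_nonneg (τ * (g y - g x)))]
  have h4 : 2 * m x * (gamOp m ω v v x - 2 * τ * gamOp m ω v g x)
      ≤ 2 * m x * gamOp m ω u u x := by linarith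
  exact le_of_mul_le_mul_left h4 (by linarith [hm x])

/-- gradient along an edge -/
lemma edge_grad (hm : ∀ x, 0 < m x) (hnn : ∀ x y, 0 ≤ ω x y) (hloc : LocallyFiniteGraph ω)
    {D : ℝ} (hD : ∀ x y, ω x y ≠ 0 → m x ≤ D * ω x y) (f : V → ℝ) {x y : V} (hxy : ω x y ≠ 0) :
    (f x - f y) ^ 2 ≤ 2 * D * gamOp m ω f f x := by
  obtain ⟨W, hW⟩ := exists_nb hloc x
  have h2 := gam_eq hm hW f f
  have h3 : ω x y * ((f y - f x) * (f y - f x)) ≤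
      ∑ y ∈ W, ω x y * ((f y - f x) * (f y - f x)) :=
    Finset.single_le_sum (f := fun y => ω x y * ((f y - f x) * (f y - f x)))
      (fun y _ => mul_nonneg (hnn x y) (mul_self_nonneg _)) (hW y hxy)
  have h4 := mul_le_mul_of_nonneg_right (hD x y hxy) (gam_nonneg hm hnn hloc f x)
  have hpos : 0 < ω x y := lt_of_le_of_ne (hnn x y) (Ne.symm hxy)
  have : ω x y * (f x - f y) ^ 2 ≤ ω x y * (2 * D * gamOp m ω f f x) := by nlinarith
  exact le_of_mul_le_mul_left this hpos

/-- maximum principle for functions vanishing at infinity -/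
lemma mp_vanish (hm : ∀ x, 0 < m x) (hnn : ∀ x y, 0 ≤ ω x y) (hloc : LocallyFiniteGraph ω)
    {c τ S : ℝ} (hc : 0 < c) (hτ : 0 ≤ τ) (hS : 0 ≤ S) (F : V → ℝ)
    (hF : ∀ ε > 0, {x | ε ≤ F x}.Finite)
    (hsub : ∀ x, 0 < F x → c * F x - τ * lapOp m ω F x ≤ S) (x : V) : c * F x ≤ S := by
  by_contra hx
  push Not at hx
  have hFx : 0 < F x := by
    by_contra h
    nlinarith
  obtain ⟨z, hz, hmax⟩ := Set.exists_max_image _ F (hF (F x) hFx) ⟨x, le_refl (F x)⟩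
  have hmax' : ∀ y, F y ≤ F z := by
    intro y
    by_cases h : F x ≤ F y
    · exact hmax y h
    · have : F x ≤ F z := hz
      linarith
  have hz' : F x ≤ F z := hz
  obtain ⟨W, hW⟩ := exists_nb hloc z
  have h1 := lap_eq hm hW F
  have h2 : ∑ y ∈ W, ω z y * (F y - F z) ≤ 0 :=
    Finset.sum_nonpos fun y _ => mul_nonpos_of_nonneg_of_nonpos (hnn z y) (by linarith [hmax' y])
  have h3 : lapOp m ω F z ≤ 0 := by
    by_contra h
    push Not at h
    have := mul_pos (hm z) h
    linarith
  have := hsub z (by linarith)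
  nlinarith

/-- maximum principle for bounded Laplacians -/
lemma mp_bdd (hm : ∀ x, 0 < m x) (hnn : ∀ x y, 0 ≤ ω x y) (hloc : LocallyFiniteGraph ω)
    {C : ℝ} (hC : ∀ x, (∑' y, ω x y) / m x ≤ C)
    {c τ S : ℝ} (hc : 0 < c) (hτ : 0 ≤ τ) (F : V → ℝ)
    (hF : BddAbove (Set.range F))
    (hsub : ∀ x, c * F x - τ * lapOp m ω F x ≤ S) (x : V) : c * F x ≤ S := by
  have hC0 : 0 ≤ C := le_trans (div_nonneg (tsum_nonneg (hnn x)) (hm x).le) (hC x)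
  have hle : ∀ y, F y ≤ sSup (Set.range F) := fun y => le_csSup hF ⟨y, rfl⟩
  set M := sSup (Set.range F) with hM
  have key : ∀ ε > 0, c * M ≤ S + (c + τ * C) * ε := by
    intro ε hε
    obtain ⟨_, ⟨z, rfl⟩, hz⟩ := exists_lt_of_lt_csSup (Set.range_nonempty_iff_nonempty.2 ⟨x⟩)
      (show M - ε < sSup (Set.range F) by linarith)
    obtain ⟨W, hW⟩ := exists_nb hloc z
    have h1 := lap_eq hm hW F
    have h2 : ∑ y ∈ W, ω z y * (F y - F z) ≤ ∑ y ∈ W, ω z y * ε :=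
      Finset.sum_le_sum fun y _ => mul_le_mul_of_nonneg_left (by linarith [hle y]) (hnn z y)
    have h3 : ∑ y ∈ W, ω z y * ε ≤ m z * (C * ε) := by
      have h4 := hC z
      have h5 := tsum_w hW (fun _ => (1 : ℝ))
      simp only [mul_one] at h5
      rw [div_le_iff₀ (hm z), h5] at h4
      rw [← Finset.sum_mul]
      nlinarith
    have h6 : lapOp m ω F z ≤ C * ε := by
      apply le_of_mul_le_mul_left _ (hm z)
      linarith
    have h7 := hsub z
    have h8 := mul_le_mul_of_nonneg_left h6 hτ
    nlinarith
  have hcM : c * M ≤ S := by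
    apply le_of_forall_pos_le_add
    intro ε hε
    have hA : 0 < c + τ * C := by positivity
    have := key (ε / (c + τ * C)) (by positivity)
    rwa [mul_div_cancel₀ _ hA.ne'] at this
  have := mul_le_mul_of_nonneg_left (hle x) hc.le
  linarith

lemma finite_of_supp {Ω : Finset V} {F : V → ℝ} (h : ∀ x, x ∉ Ω → F x = 0) :
    ∀ ε > 0, {x | ε ≤ F x}.Finite := by
  intro ε hε
  apply Ω.finite_toSet.subset
  intro x hx
  by_contra hxΩ
  have h0 := h x hxΩ
  have hx' : ε ≤ F x := hx
  linarith

lemma lap_neg (hm : ∀ x, 0 < m x) (hloc : LocallyFiniteGraph ω) (f : V → ℝ) (x : V) :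
    lapOp m ω (fun z => - f z) x = - lapOp m ω f x := by
  have := lap_lin hm hloc (-1) 0 f f x
  simpa using this

/-- maximum principle on a finite set with Dirichlet conditions -/
lemma mp_dir (hm : ∀ x, 0 < m x) (hnn : ∀ x y, 0 ≤ ω x y) (hloc : LocallyFiniteGraph ω)
    {τ S : ℝ} (hτ : 0 ≤ τ) (hS : 0 ≤ S) (Ω : Finset V) (F : V → ℝ)
    (h : ∀ x, x ∉ Ω → F x = 0)
    (hsub : ∀ x ∈ Ω, F x - τ * lapOp m ω F x ≤ S) (x : V) : F x ≤ S := by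
  have := mp_vanish hm hnn hloc one_pos hτ hS F (finite_of_supp h) (fun y hy => by
    have : y ∈ Ω := by
      by_contra h'
      exact hy.ne' (h y h')
    simpa using hsub y this) x
  simpa using this

lemma dirichlet (hm : ∀ x, 0 < m x) (hnn : ∀ x y, 0 ≤ ω x y) (hloc : LocallyFiniteGraph ω)
    {τ : ℝ} (hτ : 0 ≤ τ) (Ω : Finset V) (u : V → ℝ) (hu0 : ∀ x, 0 ≤ u x) (hu1 : ∀ x, u x ≤ 1) :
    ∃ v : V → ℝ, (∀ x, x ∉ Ω → v x = 0) ∧ (∀ x ∈ Ω, v x - τ * lapOp m ω v x = u x) ∧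
      (∀ x, 0 ≤ v x) ∧ ∀ x, v x ≤ 1 := by
  classical
  let ext : (Ω → ℝ) → V → ℝ := fun w x => if h : x ∈ Ω then w ⟨x, h⟩ else 0
  have hext0 : ∀ w x, x ∉ Ω → ext w x = 0 := fun w x hx => by simp [ext, hx]
  have hextΩ : ∀ w (x : Ω), ext w x = w x := fun w x => by simp [ext]
  let T : (Ω → ℝ) →ₗ[ℝ] (Ω → ℝ) :=
    { toFun := fun w x => ext w x - τ * lapOp m ω (ext w) x
      map_add' := by
        intro w w'
        have : ext (w + w') = fun z => 1 * ext w z + 1 * ext w' z := by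
          funext z
          by_cases hz : z ∈ Ω <;> simp [ext, hz]
        funext x
        rw [this, lap_lin hm hloc]
        simp only [Pi.add_apply]
        ring
      map_smul' := by
        intro a w
        have : ext (a • w) = fun z => a * ext w z + 0 * ext w z := by
          funext z
          by_cases hz : z ∈ Ω <;> simp [ext, hz]
        funext x
        rw [this, lap_lin hm hloc]
        simp only [Pi.smul_apply, smul_eq_mul, RingHom.id_apply]
        ring }
  have hT : ∀ w x, T w x = ext w x - τ * lapOp m ω (ext w) x := fun w x => rfl
  have hinj : Function.Injective T := by
    rw [← LinearMap.ker_eq_bot, LinearMap.ker_eq_bot']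
    intro w hw
    have heq : ∀ x ∈ Ω, ext w x - τ * lapOp m ω (ext w) x = 0 := by
      intro x hx
      have := congrFun hw ⟨x, hx⟩
      rw [hT] at this
      simpa using this
    funext x
    have h1 := mp_dir hm hnn hloc hτ le_rfl Ω (ext w) (hext0 w) (fun x hx => (heq x hx).le) x
    have h2 := mp_dir hm hnn hloc hτ le_rfl Ω (fun z => - ext w z)
      (fun x hx => by simp [hext0 w x hx])
      (fun x hx => by
        rw [lap_neg hm hloc]
        linarith [heq x hx]) x
    simp only [hextΩ] at h1 h2
    simp only [Pi.zero_apply]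
    linarith
  obtain ⟨w, hw⟩ := LinearMap.injective_iff_surjective.1 hinj (fun x => u x)
  have heq : ∀ x ∈ Ω, ext w x - τ * lapOp m ω (ext w) x = u x := by
    intro x hx
    have := congrFun hw ⟨x, hx⟩
    rw [hT] at this
    simpa using this
  refine ⟨ext w, hext0 w, heq, ?_, ?_⟩
  · intro x
    have h2 := mp_dir hm hnn hloc hτ le_rfl Ω (fun z => - ext w z)
      (fun x hx => by simp [hext0 w x hx])
      (fun x hx => by
        rw [lap_neg hm hloc]
        linarith [heq x hx, hu0 x]) x
    linarith
  · exact mp_dir hm hnn hloc hτ zero_le_one Ω (ext w) (hext0 w)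
      (fun x hx => by linarith [heq x hx, hu1 x])

/-- Green's formula, as an inequality -/
lemma energy (hm : ∀ x, 0 < m x) (hnn : ∀ x y, 0 ≤ ω x y) (hsymm : ∀ x y, ω x y = ω y x)
    (hloc : LocallyFiniteGraph ω) (Ω : Finset V) (v : V → ℝ) (hv : ∀ x, x ∉ Ω → v x = 0)
    (s : Finset V) :
    ∑ x ∈ s, m x * gamOp m ω v v x ≤ ∑ x ∈ Ω, m x * v x * (- lapOp m ω v x) := by
  classical
  obtain ⟨W, hsW, hW⟩ := exists_nbs hloc (s ∪ Ω)
  have hs : s ⊆ W := Finset.subset_union_left.trans hsW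
  have hΩ : Ω ⊆ W := Finset.subset_union_right.trans hsW
  have h1 : 2 * ∑ x ∈ s, m x * gamOp m ω v v x
      ≤ ∑ x ∈ W, ∑ y ∈ W, ω x y * ((v y - v x) * (v y - v x)) := by
    rw [Finset.mul_sum]
    calc ∑ x ∈ s, 2 * (m x * gamOp m ω v v x)
        = ∑ x ∈ s, ∑ y ∈ W, ω x y * ((v y - v x) * (v y - v x)) :=
          Finset.sum_congr rfl fun x hx =>
            gam_eq hm (hW x (Finset.mem_union_left _ hx)) v v
      _ ≤ _ := Finset.sum_le_sum_of_subset_of_nonneg hs fun x _ _ =>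
          Finset.sum_nonneg fun y _ => mul_nonneg (hnn x y) (mul_self_nonneg _)
  have h2 : ∑ x ∈ Ω, m x * v x * (- lapOp m ω v x)
      = ∑ x ∈ W, ∑ y ∈ W, ω x y * (v x * (v x - v y)) := by
    calc ∑ x ∈ Ω, m x * v x * (- lapOp m ω v x)
        = ∑ x ∈ Ω, ∑ y ∈ W, ω x y * (v x * (v x - v y)) := by
          apply Finset.sum_congr rfl
          intro x hx
          have := lap_eq hm (hW x (Finset.mem_union_right _ hx)) v
          calc m x * v x * (- lapOp m ω v x) = (- v x) * (m x * lapOp m ω v x) := by ring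
            _ = _ := by
              rw [this, Finset.mul_sum]
              exact Finset.sum_congr rfl fun y _ => by ring
      _ = _ := Finset.sum_subset hΩ fun x _ hx => by simp [hv x hx]
  have h3 : ∑ x ∈ W, ∑ y ∈ W, ω x y * (v x * (v x - v y))
      = ∑ x ∈ W, ∑ y ∈ W, ω x y * (v y * (v y - v x)) := by
    rw [Finset.sum_comm]
    exact Finset.sum_congr rfl fun x _ => Finset.sum_congr rfl fun y _ => by rw [hsymm x y]
  have h4 : ∑ x ∈ W, ∑ y ∈ W, ω x y * ((v y - v x) * (v y - v x))
      = ∑ x ∈ W, ∑ y ∈ W, ω x y * (v x * (v x - v y))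
        + ∑ x ∈ W, ∑ y ∈ W, ω x y * (v y * (v y - v x)) := by
    rw [← Finset.sum_add_distrib]
    refine Finset.sum_congr rfl fun x _ => ?_
    rw [← Finset.sum_add_distrib]
    exact Finset.sum_congr rfl fun y _ => by ring
  linarith

lemma lap_tendsto (hm : ∀ x, 0 < m x) (hloc : LocallyFiniteGraph ω) {ι : Type*} {l : Filter ι}
    {f : ι → V → ℝ} {v : V → ℝ} (h : ∀ x, Tendsto (fun i => f i x) l (𝓝 (v x))) (x : V) :
    Tendsto (fun i => lapOp m ω (f i) x) l (𝓝 (lapOp m ω v x)) := by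
  obtain ⟨W, hW⟩ := exists_nb hloc x
  have e : ∀ g : V → ℝ, lapOp m ω g x = (m x)⁻¹ * ∑ y ∈ W, ω x y * (g y - g x) := by
    intro g
    rw [← lap_eq hm hW, inv_mul_cancel_left₀ (hm x).ne']
  simp_rw [e]
  exact Tendsto.const_mul _ (tendsto_finsetSum _ fun y _ => Tendsto.const_mul _ ((h y).sub (h x)))

lemma gam_tendsto (hm : ∀ x, 0 < m x) (hloc : LocallyFiniteGraph ω) {ι : Type*} {l : Filter ι}
    {f : ι → V → ℝ} {v : V → ℝ} (h : ∀ x, Tendsto (fun i => f i x) l (𝓝 (v x))) (x : V) :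
    Tendsto (fun i => gamOp m ω (f i) (f i) x) l (𝓝 (gamOp m ω v v x)) := by
  obtain ⟨W, hW⟩ := exists_nb hloc x
  have e : ∀ g : V → ℝ, gamOp m ω g g x
      = (2 * m x)⁻¹ * ∑ y ∈ W, ω x y * ((g y - g x) * (g y - g x)) := by
    intro g
    have := (hm x).ne'
    rw [← gam_eq hm hW]
    field_simp
  simp_rw [e]
  exact Tendsto.const_mul _ (tendsto_finsetSum _ fun y _ => Tendsto.const_mul _
    (((h y).sub (h x)).mul ((h y).sub (h x))))

/-- existence of the resolvent -/
lemma resolvent (hm : ∀ x, 0 < m x) (hnn : ∀ x y, 0 ≤ ω x y) (hsymm : ∀ x y, ω x y = ω y x)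
    (hloc : LocallyFiniteGraph ω) {lam : ℝ} (hlam : 0 ≤ lam)
    (hray : ∀ (Ω : Finset V) (v : V → ℝ), (∀ x, x ∉ Ω → v x = 0) →
      lam * ∑ x ∈ Ω, m x * v x ^ 2 ≤ ∑ x ∈ Ω, m x * v x * (- lapOp m ω v x))
    {τ : ℝ} (hτ : 0 < τ) (u : V → ℝ) (hu0 : ∀ x, 0 ≤ u x) (hu1 : ∀ x, u x ≤ 1) :
    ∃ v : V → ℝ, (∀ x, v x - τ * lapOp m ω v x = u x) ∧
      (∀ x, 0 ≤ v x) ∧ (∀ x, v x ≤ 1) ∧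
      ∀ B, (∀ s : Finset V, ∑ x ∈ s, m x * u x ^ 2 ≤ B) →
        (∀ s : Finset V, (1 + lam * τ) ^ 2 * ∑ x ∈ s, m x * v x ^ 2 ≤ B) ∧
        ∀ s : Finset V, τ * ∑ x ∈ s, m x * gamOp m ω v v x ≤ B := by
  classical
  choose f hf0 hfe hfn hf1 using fun Ω : Finset V => dirichlet hm hnn hloc hτ.le Ω u hu0 hu1
  let l : Ultrafilter (Finset V) := Ultrafilter.of atTop
  have hl : (l : Filter (Finset V)) ≤ atTop := Ultrafilter.of_le _
  have hlim : ∀ x, ∃ a, Tendsto (fun Ω => f Ω x) l (𝓝 a) := by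
    intro x
    have hc : IsCompact (Set.Icc (0 : ℝ) 1) := isCompact_Icc
    have := hc.ultrafilter_le_nhds (l.map fun Ω => f Ω x) (by
      simp only [le_principal_iff, Ultrafilter.mem_coe, Ultrafilter.mem_map]
      exact Filter.univ_mem' fun Ω => ⟨hfn Ω x, hf1 Ω x⟩)
    obtain ⟨a, _, ha⟩ := this
    exact ⟨a, ha⟩
  choose v hv using hlim
  have hev : ∀ x, ∀ᶠ Ω in (l : Filter (Finset V)), x ∈ Ω := by
    intro x
    apply hl
    filter_upwards [eventually_ge_atTop {x}] with Ω hΩ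
    exact hΩ (Finset.mem_singleton_self x)
  refine ⟨v, ?_, ?_, ?_, ?_⟩
  · intro x
    have h1 := (hv x).sub ((lap_tendsto hm hloc hv x).const_mul τ)
    refine tendsto_nhds_unique h1 (tendsto_const_nhds.congr' ?_)
    filter_upwards [hev x] with Ω hΩ
    exact (hfe Ω x hΩ).symm
  · exact fun x => ge_of_tendsto' (hv x) fun Ω => hfn Ω x
  · exact fun x => le_of_tendsto' (hv x) fun Ω => hf1 Ω x
  · intro B hB
    have base : ∀ Ω : Finset V, (1 + lam * τ) ^ 2 * ∑ x ∈ Ω, m x * f Ω x ^ 2 ≤ B ∧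
        τ * ∑ x ∈ Ω, m x * f Ω x * (- lapOp m ω (f Ω) x) ≤ B := by
      intro Ω
      set X := ∑ x ∈ Ω, m x * f Ω x ^ 2 with hX
      set En := ∑ x ∈ Ω, m x * f Ω x * (- lapOp m ω (f Ω) x) with hEn
      set Y := ∑ x ∈ Ω, m x * u x ^ 2 with hY
      set Z := ∑ x ∈ Ω, m x * (f Ω x * u x) with hZ
      have hYB : Y ≤ B := hB Ω
      have hX0 : 0 ≤ X := Finset.sum_nonneg fun x _ => mul_nonneg (hm x).le (sq_nonneg _)
      have hZe : Z = X + τ * En := by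
        rw [hZ, hX, hEn, Finset.mul_sum, ← Finset.sum_add_distrib]
        refine Finset.sum_congr rfl fun x hx => ?_
        rw [← hfe Ω x hx]
        ring
      have hr : lam * X ≤ En := hray Ω (f Ω) (hf0 Ω)
      -- with `a = 1 + lam τ`: `2 a Z ≤ a² X + Y`
      have hcs : ∀ a : ℝ, 2 * a * Z ≤ a ^ 2 * X + Y := by
        intro a
        rw [hZ, hX, hY, Finset.mul_sum, Finset.mul_sum, ← Finset.sum_add_distrib]
        refine Finset.sum_le_sum fun x _ => ?_
        nlinarith [mul_nonneg (hm x).le (sq_nonneg (a * f Ω x - u x))]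
      have ha : 0 < 1 + lam * τ := by positivity
      constructor
      · have h1 := hcs (1 + lam * τ)
        have h2 : (1 + lam * τ) * X ≤ Z := by
          rw [hZe]
          nlinarith
        nlinarith
      · have h1 := hcs 1
        have h3 := hcs 2
        nlinarith
    constructor
    · intro s
      have h1 : Tendsto (fun Ω => (1 + lam * τ) ^ 2 * ∑ x ∈ s, m x * f Ω x ^ 2) l
          (𝓝 ((1 + lam * τ) ^ 2 * ∑ x ∈ s, m x * v x ^ 2)) :=
        Tendsto.const_mul _ (tendsto_finsetSum _ fun x _ => Tendsto.const_mul _ ((hv x).pow 2))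
      refine le_of_tendsto h1 ?_
      filter_upwards [hl (eventually_ge_atTop s)] with Ω hΩ
      refine le_trans (mul_le_mul_of_nonneg_left ?_ (sq_nonneg _)) (base Ω).1
      exact Finset.sum_le_sum_of_subset_of_nonneg hΩ fun x _ _ =>
        mul_nonneg (hm x).le (sq_nonneg _)
    · intro s
      have h1 : Tendsto (fun Ω => τ * ∑ x ∈ s, m x * gamOp m ω (f Ω) (f Ω) x) l
          (𝓝 (τ * ∑ x ∈ s, m x * gamOp m ω v v x)) :=
        Tendsto.const_mul _ (tendsto_finsetSum _ fun x _ =>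
          Tendsto.const_mul _ (gam_tendsto hm hloc hv x))
      refine le_of_tendsto' h1 fun Ω => ?_
      exact le_trans (mul_le_mul_of_nonneg_left
        (energy hm hnn hsymm hloc Ω (f Ω) (hf0 Ω) s) hτ.le) (base Ω).2

/-- the maximum principle under assumption (A) -/
lemma mp_A (hm : ∀ x, 0 < m x) (hnn : ∀ x y, 0 ≤ ω x y) (hloc : LocallyFiniteGraph ω)
    (hA : AssumptionA m ω) {c τ S a E B : ℝ} (hc : 0 < c) (hτ : 0 ≤ τ) (hS : 0 ≤ S) (ha : 0 ≤ a)
    (v w : V → ℝ) (hv0 : ∀ x, 0 ≤ v x) (hv1 : ∀ x, v x ≤ 1)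
    (hw0 : ∀ x, 0 ≤ w x) (hw1 : ∀ x, w x ≤ 1)
    (hE : ∀ s : Finset V, ∑ x ∈ s, m x * gamOp m ω v v x ≤ E)
    (hB : ∀ s : Finset V, ∑ x ∈ s, m x * w x ^ 2 ≤ B)
    (hsub : ∀ x, c * (a * gamOp m ω v v x + 1 * w x ^ 2)
      - τ * lapOp m ω (fun x => a * gamOp m ω v v x + 1 * w x ^ 2) x ≤ S) (x : V) :
    c * (a * gamOp m ω v v x + 1 * w x ^ 2) ≤ S := by
  rcases hA with ⟨C, hC⟩ | ⟨_, δ, hδ, hmδ⟩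
  · refine mp_bdd hm hnn hloc hC hc hτ (fun x => a * gamOp m ω v v x + 1 * w x ^ 2) ?_ hsub x
    refine ⟨a * C + 1, ?_⟩
    rintro _ ⟨y, rfl⟩
    have h1 : w y ^ 2 ≤ 1 := by nlinarith [hw0 y, hw1 y]
    have h2 : gamOp m ω v v y ≤ C := by
      obtain ⟨W, hW⟩ := exists_nb hloc y
      have h3 := gam_eq hm hW v v
      have h4 := hC y
      have h5 := tsum_w hW (fun _ => (1 : ℝ))
      simp only [mul_one] at h5
      rw [div_le_iff₀ (hm y), h5] at h4
      have h6 : ∑ z ∈ W, ω y z * ((v z - v y) * (v z - v y)) ≤ ∑ z ∈ W, ω y z := by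
        refine Finset.sum_le_sum fun z _ => mul_le_of_le_one_right (hnn y z) ?_
        nlinarith [hv0 y, hv1 y, hv0 z, hv1 z]
      have h7 : 0 ≤ ∑ z ∈ W, ω y z := Finset.sum_nonneg fun z _ => hnn y z
      apply le_of_mul_le_mul_left _ (hm y)
      linarith
    have := mul_le_mul_of_nonneg_left h2 ha
    simp only
    linarith
  · refine mp_vanish hm hnn hloc hc hτ hS (fun x => a * gamOp m ω v v x + 1 * w x ^ 2) ?_
      (fun x _ => hsub x) x
    intro ε hε
    by_contra hinf
    obtain ⟨n, hn⟩ := exists_nat_gt ((a * E + B) / (δ * ε))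
    obtain ⟨s, hs, hcard⟩ := Set.Infinite.exists_subset_card_eq hinf n
    have h1 : ∑ x ∈ s, m x * (a * gamOp m ω v v x + 1 * w x ^ 2) ≤ a * E + B := by
      have e : ∑ x ∈ s, m x * (a * gamOp m ω v v x + 1 * w x ^ 2)
          = a * ∑ x ∈ s, m x * gamOp m ω v v x + ∑ x ∈ s, m x * w x ^ 2 := by
        rw [Finset.mul_sum, ← Finset.sum_add_distrib]
        exact Finset.sum_congr rfl fun y _ => by ring
      rw [e]
      exact add_le_add (mul_le_mul_of_nonneg_left (hE s) ha) (hB s)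
    have h2 : (n : ℝ) * (δ * ε) ≤ ∑ x ∈ s, m x * (a * gamOp m ω v v x + 1 * w x ^ 2) := by
      rw [← hcard, ← nsmul_eq_mul]
      refine Finset.card_nsmul_le_sum s _ _ fun y hy => ?_
      exact mul_le_mul (hmδ y) (hs hy) hε.le (hm y).le
    rw [div_lt_iff₀ (by positivity)] at hn
    linarith

/-- implicit Euler scheme -/
lemma euler_seq (hm : ∀ x, 0 < m x) (hnn : ∀ x y, 0 ≤ ω x y) (hsymm : ∀ x y, ω x y = ω y x)
    (hloc : LocallyFiniteGraph ω) {lam : ℝ} (hlam : 0 ≤ lam)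
    (hray : ∀ (Ω : Finset V) (v : V → ℝ), (∀ x, x ∉ Ω → v x = 0) →
      lam * ∑ x ∈ Ω, m x * v x ^ 2 ≤ ∑ x ∈ Ω, m x * v x * (- lapOp m ω v x))
    {τ : ℝ} (hτ : 0 < τ) (u0 : V → ℝ) (hu0 : ∀ x, 0 ≤ u0 x) (hu1 : ∀ x, u0 x ≤ 1) (B : ℝ)
    (hB : ∀ s : Finset V, ∑ x ∈ s, m x * u0 x ^ 2 ≤ B) :
    ∃ u : ℕ → V → ℝ, u 0 = u0 ∧
      (∀ n x, u (n + 1) x - τ * lapOp m ω (u (n + 1)) x = u n x) ∧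
      (∀ n x, 0 ≤ u n x) ∧ (∀ n x, u n x ≤ 1) ∧
      (∀ n (s : Finset V), ((1 + lam * τ) ^ n) ^ 2 * ∑ x ∈ s, m x * u n x ^ 2 ≤ B) ∧
      ∀ n, ∃ E, ∀ s : Finset V, ∑ x ∈ s, m x * gamOp m ω (u (n + 1)) (u (n + 1)) x ≤ E := by
  have hp : 0 < 1 + lam * τ := by positivity
  let X := {u : V → ℝ // (∀ x, 0 ≤ u x) ∧ ∀ x, u x ≤ 1}
  choose R hR1 hR2 hR3 hR4 using fun u : X =>
    resolvent hm hnn hsymm hloc hlam hray hτ u.1 u.2.1 u.2.2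
  let R' : X → X := fun u => ⟨R u, hR2 u, hR3 u⟩
  let U : ℕ → X := fun n => Nat.rec ⟨u0, hu0, hu1⟩ (fun _ w => R' w) n
  have hU : ∀ n, (U (n + 1)).1 = R (U n) := fun n => rfl
  have hUB : ∀ n (s : Finset V), ((1 + lam * τ) ^ n) ^ 2 * ∑ x ∈ s, m x * (U n).1 x ^ 2 ≤ B := by
    intro n
    induction n with
    | zero =>
      intro s
      have h0 : (U 0).1 = u0 := rfl
      rw [h0]
      simpa using hB s
    | succ n ih =>
      intro s
      have h1 : ∀ s : Finset V, ∑ x ∈ s, m x * (U n).1 x ^ 2 ≤ B / ((1 + lam * τ) ^ n) ^ 2 := by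
        intro s
        rw [le_div_iff₀ (by positivity), mul_comm]
        exact ih s
      have h2 := (hR4 (U n) _ h1).1 s
      rw [le_div_iff₀ (by positivity)] at h2
      rw [hU]
      calc _ = (1 + lam * τ) ^ 2 * ∑ x ∈ s, m x * R (U n) x ^ 2 * ((1 + lam * τ) ^ n) ^ 2 := by
            rw [← Finset.sum_mul]; ring
        _ ≤ B := by rw [← Finset.sum_mul, ← mul_assoc]; exact h2
  refine ⟨fun n => (U n).1, rfl, fun n x => hR1 (U n) x, fun n => (U n).2.1, fun n => (U n).2.2,
    hUB, ?_⟩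
  intro n
  have h1 : ∀ s : Finset V, ∑ x ∈ s, m x * (U n).1 x ^ 2 ≤ B / ((1 + lam * τ) ^ n) ^ 2 := by
    intro s
    rw [le_div_iff₀ (by positivity), mul_comm]
    exact hUB n s
  refine ⟨B / ((1 + lam * τ) ^ n) ^ 2 / τ, fun s => ?_⟩
  have h2 := (hR4 (U n) _ h1).2 s
  rw [le_div_iff₀ hτ, mul_comm]
  exact h2

/-- gradient estimate along the Euler scheme -/
lemma grad_est (hm : ∀ x, 0 < m x) (hnn : ∀ x y, 0 ≤ ω x y) (hloc : LocallyFiniteGraph ω)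
    (hA : AssumptionA m ω) {k τ : ℝ} (hk : 0 ≤ k) (hτ : 0 < τ) (hkτ : 2 * k * τ < 1)
    (hCD : ∀ (f : V → ℝ) (x : V), gam2Op m ω f x ≥ - k * gamOp m ω f f x)
    (u : ℕ → V → ℝ) (hu : ∀ n x, u (n + 1) x - τ * lapOp m ω (u (n + 1)) x = u n x)
    (hu0 : ∀ n x, 0 ≤ u n x) (hu1 : ∀ n x, u n x ≤ 1)
    (hB : ∀ n, ∃ B, ∀ s : Finset V, ∑ x ∈ s, m x * u n x ^ 2 ≤ B)
    (hE : ∀ n, ∃ E, ∀ s : Finset V, ∑ x ∈ s, m x * gamOp m ω (u (n + 1)) (u (n + 1)) x ≤ E)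
    (n : ℕ) : ∀ x, (1 - 2 * k * τ) ^ n *
      ((2 * τ * n) * gamOp m ω (u (n + 1)) (u (n + 1)) x + 1 * u n x ^ 2) ≤ 1 := by
  have hc : 0 < 1 - 2 * k * τ := by linarith
  induction n with
  | zero =>
    intro x
    simp only [pow_zero, Nat.cast_zero, mul_zero, zero_mul, zero_add, one_mul]
    nlinarith [hu0 0 x, hu1 0 x]
  | succ n ih =>
    intro x
    obtain ⟨B, hB⟩ := hB (n + 1)
    obtain ⟨E, hE⟩ := hE (n + 1)
    have ha : 0 ≤ 2 * τ * ((n + 1 : ℕ) : ℝ) := by positivity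
    have hS : 0 ≤ ((1 - 2 * k * τ) ^ n)⁻¹ := by positivity
    have key := mp_A hm hnn hloc hA hc hτ.le hS ha (u (n + 2)) (u (n + 1)) (hu0 _) (hu1 _)
      (hu0 _) (hu1 _) hE hB ?_ x
    · rw [pow_succ, mul_assoc]
      calc _ ≤ (1 - 2 * k * τ) ^ n * ((1 - 2 * k * τ) ^ n)⁻¹ :=
            mul_le_mul_of_nonneg_left key (by positivity)
        _ = 1 := mul_inv_cancel₀ (by positivity)
    · intro y
      have h1 := lap_lin hm hloc (2 * τ * ((n + 1 : ℕ) : ℝ)) 1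
        (fun x => gamOp m ω (u (n + 2)) (u (n + 2)) x) (fun x => u (n + 1) x ^ 2) y
      rw [h1, lap_sq hm hloc]
      have h2 := gam_step hm hnn hloc τ (u (n + 1)) (u (n + 2)) (lapOp m ω (u (n + 2)))
        (hu (n + 1)) y
      have h3 := hCD (u (n + 2)) y
      unfold gam2Op at h3
      have h4 := ih y
      have h5 : (2 * τ * n) * gamOp m ω (u (n + 1)) (u (n + 1)) y + 1 * u n y ^ 2
          ≤ ((1 - 2 * k * τ) ^ n)⁻¹ := by
        rw [← one_div, le_div_iff₀ (by positivity), mul_comm]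
        exact h4
      refine le_trans ?_ h5
      have h6 := hu n y
      set A := gamOp m ω (u (n + 2)) (u (n + 2)) y
      set L := lapOp m ω (fun z => gamOp m ω (u (n + 2)) (u (n + 2)) z) y
      set G := gamOp m ω (u (n + 2)) (lapOp m ω (u (n + 2))) y
      set H := gamOp m ω (u (n + 1)) (u (n + 1)) y
      set p := u (n + 1) y
      set d := lapOp m ω (u (n + 1)) y
      have h7 : (1 - 2 * k * τ) * A - τ * L ≤ H := by nlinarith
      have h8 := mul_le_mul_of_nonneg_left h7 ha
      have h9 : (1 - 2 * k * τ) * p ^ 2 ≤ p ^ 2 :=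
        mul_le_of_le_one_left (sq_nonneg _) (by nlinarith)
      rw [← h6]
      push_cast at h8 ⊢
      nlinarith [sq_nonneg (τ * d)]

/-- the boundary term -/
lemma bdry_est (hm : ∀ x, 0 < m x) (hnn : ∀ x y, 0 ≤ ω x y) (hsymm : ∀ x y, ω x y = ω y x)
    (U W : Finset V) [DecidableEq V] (hUW : U ⊆ W) (hW : ∀ x ∈ U, ∀ y, ω x y ≠ 0 → y ∈ W)
    (f : V → ℝ) (G : ℝ) (hG : ∀ x y, ω x y ≠ 0 → f x - f y ≤ G) :
    ∑ x ∈ U, m x * (- lapOp m ω f x) ≤ G * ∑ x ∈ U, ∑ y ∈ W \ U, ω x y := by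
  have h1 : ∑ x ∈ U, m x * (- lapOp m ω f x) = ∑ x ∈ U, ∑ y ∈ W, ω x y * (f x - f y) := by
    refine Finset.sum_congr rfl fun x hx => ?_
    rw [mul_neg, lap_eq hm (hW x hx), ← Finset.sum_neg_distrib]
    exact Finset.sum_congr rfl fun y _ => by ring
  have h2 : ∑ x ∈ U, ∑ y ∈ W, ω x y * (f x - f y)
      = ∑ x ∈ U, ∑ y ∈ W \ U, ω x y * (f x - f y) + ∑ x ∈ U, ∑ y ∈ U, ω x y * (f x - f y) := by
    rw [← Finset.sum_add_distrib]
    exact Finset.sum_congr rfl fun x _ => (Finset.sum_sdiff hUW).symm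
  have h3 : ∑ x ∈ U, ∑ y ∈ U, ω x y * (f x - f y) = - ∑ x ∈ U, ∑ y ∈ U, ω x y * (f x - f y) := by
    conv_lhs => rw [Finset.sum_comm]
    rw [← Finset.sum_neg_distrib]
    refine Finset.sum_congr rfl fun x _ => ?_
    rw [← Finset.sum_neg_distrib]
    refine Finset.sum_congr rfl fun y _ => ?_
    rw [hsymm x y]; ring
  have h4 : ∑ x ∈ U, ∑ y ∈ W \ U, ω x y * (f x - f y) ≤ G * ∑ x ∈ U, ∑ y ∈ W \ U, ω x y := by
    rw [Finset.mul_sum]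
    refine Finset.sum_le_sum fun x _ => ?_
    rw [Finset.mul_sum]
    refine Finset.sum_le_sum fun y _ => ?_
    by_cases h : ω x y = 0
    · simp [h]
    · rw [mul_comm G]
      exact mul_le_mul_of_nonneg_left (hG x y h) (hnn x y)
  linarith

lemma sqrt_step (n : ℕ) : 1 / √((n : ℝ) + 1) + 2 * √(n : ℝ) ≤ 2 * √((n : ℝ) + 1) := by
  have h1 : 0 < √((n : ℝ) + 1) := Real.sqrt_pos.2 (by positivity)
  have h2 := Real.sq_sqrt (show (0 : ℝ) ≤ (n : ℝ) + 1 by positivity)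
  have h3 := Real.sq_sqrt (show (0 : ℝ) ≤ (n : ℝ) by positivity)
  set a := √((n : ℝ) + 1)
  set b := √(n : ℝ)
  rw [div_add' _ _ _ h1.ne', div_le_iff₀ h1]
  nlinarith [sq_nonneg (a - b)]

/-- estimate at finite step size -/
lemma main_est (hm : ∀ x, 0 < m x) (hnn : ∀ x y, 0 ≤ ω x y) (hsymm : ∀ x y, ω x y = ω y x)
    (hloc : LocallyFiniteGraph ω) (hA : AssumptionA m ω) {lam : ℝ} (hlam : 0 ≤ lam)
    (hray : ∀ (Ω : Finset V) (v : V → ℝ), (∀ x, x ∉ Ω → v x = 0) →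
      lam * ∑ x ∈ Ω, m x * v x ^ 2 ≤ ∑ x ∈ Ω, m x * v x * (- lapOp m ω v x))
    {k τ D : ℝ} (hk : 0 ≤ k) (hτ : 0 < τ) (hkτ : 2 * k * τ < 1) (hD0 : 0 < D)
    (hD : ∀ x y, ω x y ≠ 0 → m x ≤ D * ω x y)
    (hCD : ∀ (f : V → ℝ) (x : V), gam2Op m ω f x ≥ - k * gamOp m ω f f x)
    [DecidableEq V] (U W : Finset V) (hUW : U ⊆ W) (hW : ∀ x ∈ U, ∀ y, ω x y ≠ 0 → y ∈ W)
    (N : ℕ) :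
    (∑ x ∈ U, m x) * (1 - ((1 + lam * τ) ^ N)⁻¹) ≤
      (∑ x ∈ U, ∑ y ∈ W \ U, ω x y) * (τ * (1 + √(D / (τ * (1 - 2 * k * τ) ^ N)) * (2 * √N))) := by
  have hc : 0 < 1 - 2 * k * τ := by linarith
  have hc1 : 1 - 2 * k * τ ≤ 1 := by nlinarith
  have hp : 1 ≤ 1 + lam * τ := by nlinarith
  set c := 1 - 2 * k * τ with hcdef
  set P := ∑ x ∈ U, ∑ y ∈ W \ U, ω x y with hP
  have hP0 : 0 ≤ P := Finset.sum_nonneg fun x _ => Finset.sum_nonneg fun y _ => hnn x y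
  set vol := ∑ x ∈ U, m x with hvol
  obtain ⟨u, hu_zero, hu, hu0, hu1, hl2, hE⟩ := euler_seq hm hnn hsymm hloc hlam hray hτ
    (fun x => if x ∈ U then 1 else 0) (fun x => by split_ifs <;> norm_num)
    (fun x => by split_ifs <;> norm_num) vol (by
      intro s
      calc ∑ x ∈ s, m x * (if x ∈ U then (1 : ℝ) else 0) ^ 2
          = ∑ x ∈ s ∩ U, m x := by
            rw [← Finset.sum_filter_add_sum_filter_not s (· ∈ U), Finset.filter_mem_eq_inter]
            rw [Finset.sum_congr rfl (g := m) (fun x hx => by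
              simp [(Finset.mem_inter.1 hx).2])]
            rw [Finset.sum_eq_zero (s := s.filter (¬ · ∈ U)) (fun x hx => by
              simp [(Finset.mem_filter.1 hx).2]), add_zero]
        _ ≤ vol := Finset.sum_le_sum_of_subset_of_nonneg Finset.inter_subset_right
            fun x _ _ => (hm x).le)
  have hgrad := grad_est hm hnn hloc hA hk hτ hkτ hCD u hu hu0 hu1 (fun n =>
    ⟨vol, fun s => le_trans (le_mul_of_one_le_left
      (Finset.sum_nonneg fun x _ => mul_nonneg (hm x).le (sq_nonneg _))
      (one_le_pow₀ (one_le_pow₀ hp))) (hl2 n s)⟩) hE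
  rw [← hcdef] at hgrad
  set Q := √(D / (τ * c ^ N)) with hQ
  have hQ0 : 0 ≤ Q := Real.sqrt_nonneg _
  -- one step of the scheme
  have hstep : ∀ n G, (∀ x y, ω x y ≠ 0 → u (n + 1) x - u (n + 1) y ≤ G) →
      ∑ x ∈ U, m x * u n x - ∑ x ∈ U, m x * u (n + 1) x ≤ τ * (G * P) := by
    intro n G hG
    have h1 := mul_le_mul_of_nonneg_left
      (bdry_est hm hnn hsymm U W hUW hW (u (n + 1)) G hG) hτ.le
    refine le_trans (le_of_eq ?_) h1
    rw [← Finset.sum_sub_distrib, Finset.mul_sum]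
    refine Finset.sum_congr rfl fun x _ => ?_
    rw [← hu n x]; ring
  have hclaim : ∀ n ≤ N, vol - ∑ x ∈ U, m x * u (n + 1) x ≤ P * (τ * (1 + Q * (2 * √n))) := by
    intro n
    induction n with
    | zero =>
      intro _
      have h1 := hstep 0 1 (fun x y _ => by linarith [hu0 1 y, hu1 1 x])
      have h2 : ∑ x ∈ U, m x * u 0 x = vol := by
        refine Finset.sum_congr rfl fun x hx => ?_
        simp [hu_zero, hx]
      rw [h2] at h1
      simp only [Nat.cast_zero, Real.sqrt_zero, mul_zero, add_zero]
      simp only [zero_add] at h1 ⊢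
      linarith
    | succ n ih =>
      intro hn
      have ih := ih (by omega)
      have hs : 0 < √((n : ℝ) + 1) := Real.sqrt_pos.2 (by positivity)
      have h1 := hstep (n + 1) (Q * (1 / √((n : ℝ) + 1))) (by
        intro x y hxy
        have h2 := edge_grad hm hnn hloc hD (u (n + 1 + 1)) hxy
        have h3 := hgrad (n + 1) x
        have hcn : c ^ N ≤ c ^ (n + 1) := pow_le_pow_of_le_one hc.le hc1 hn
        have hcN : 0 < c ^ N := by positivity
        have hΓ := gam_nonneg hm hnn hloc (u (n + 1 + 1)) x
        set Γ := gamOp m ω (u (n + 1 + 1)) (u (n + 1 + 1)) x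
        have h4 : c ^ N * (2 * τ * ((n + 1 : ℕ) : ℝ) * Γ) ≤ 1 := by
          refine le_trans ?_ h3
          refine mul_le_mul hcn ?_ (by positivity) (by positivity)
          nlinarith [sq_nonneg (u (n + 1) x)]
        have h5 : (u (n + 1 + 1) x - u (n + 1 + 1) y) ^ 2 ≤ D / (τ * c ^ N) / ((n : ℝ) + 1) := by
          refine le_trans h2 ?_
          rw [div_div, le_div_iff₀ (by positivity)]
          push_cast at h4
          nlinarith
        have h6 := Real.abs_le_sqrt h5
        rw [Real.sqrt_div (by positivity)] at h6
        rw [mul_one_div]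
        exact le_trans (le_abs_self _) h6)
      have h7 := mul_le_mul_of_nonneg_left (sqrt_step n)
        (show 0 ≤ P * (τ * Q) by positivity)
      push_cast
      nlinarith
  have hfin := hclaim N le_rfl
  have hdecay : ∑ x ∈ U, m x * u (N + 1) x ≤ vol * ((1 + lam * τ) ^ N)⁻¹ := by
    set p := (1 + lam * τ) ^ N with hpdef
    have hp0 : 0 < p := by positivity
    have hpp : p ≤ (1 + lam * τ) ^ (N + 1) := pow_le_pow_right₀ hp (Nat.le_succ N)
    have h1 := hl2 (N + 1) U
    have hs0 : 0 ≤ ∑ x ∈ U, m x * u (N + 1) x ^ 2 :=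
      Finset.sum_nonneg fun x _ => mul_nonneg (hm x).le (sq_nonneg _)
    have h2 : p ^ 2 * ∑ x ∈ U, m x * u (N + 1) x ^ 2 ≤ vol :=
      le_trans (mul_le_mul_of_nonneg_right (pow_le_pow_left₀ hp0.le hpp 2) hs0) h1
    have h3 : 2 * p * ∑ x ∈ U, m x * u (N + 1) x ≤
        p ^ 2 * ∑ x ∈ U, m x * u (N + 1) x ^ 2 + vol := by
      rw [hvol, Finset.mul_sum, Finset.mul_sum, ← Finset.sum_add_distrib]
      refine Finset.sum_le_sum fun x _ => ?_
      nlinarith [mul_nonneg (hm x).le (sq_nonneg (p * u (N + 1) x - 1))]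
    rw [← div_eq_mul_inv, le_div_iff₀ hp0]
    linarith
  calc vol * (1 - ((1 + lam * τ) ^ N)⁻¹) = vol - vol * ((1 + lam * τ) ^ N)⁻¹ := by ring
    _ ≤ _ := by linarith

/-- the estimate in the limit of small step size -/
lemma limit_est (hm : ∀ x, 0 < m x) (hnn : ∀ x y, 0 ≤ ω x y) (hsymm : ∀ x y, ω x y = ω y x)
    (hloc : LocallyFiniteGraph ω) (hA : AssumptionA m ω) {lam : ℝ} (hlam : 0 ≤ lam)
    (hray : ∀ (Ω : Finset V) (v : V → ℝ), (∀ x, x ∉ Ω → v x = 0) →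
      lam * ∑ x ∈ Ω, m x * v x ^ 2 ≤ ∑ x ∈ Ω, m x * v x * (- lapOp m ω v x))
    {k t D : ℝ} (hk : 0 ≤ k) (ht : 0 < t) (hD0 : 0 < D)
    (hD : ∀ x y, ω x y ≠ 0 → m x ≤ D * ω x y)
    (hCD : ∀ (f : V → ℝ) (x : V), gam2Op m ω f x ≥ - k * gamOp m ω f f x)
    [DecidableEq V] (U W : Finset V) (hUW : U ⊆ W) (hW : ∀ x ∈ U, ∀ y, ω x y ≠ 0 → y ∈ W) :
    (∑ x ∈ U, m x) * (1 - Real.exp (-(lam * t))) ≤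
      (∑ x ∈ U, ∑ y ∈ W \ U, ω x y) * (2 * √(D * t * Real.exp (2 * k * t))) := by
  have hL : Tendsto (fun N : ℕ => (∑ x ∈ U, m x) * (1 - ((1 + (lam * t) / N) ^ N)⁻¹)) atTop
      (𝓝 ((∑ x ∈ U, m x) * (1 - Real.exp (-(lam * t))))) := by
    rw [Real.exp_neg]
    exact Tendsto.const_mul _ (tendsto_const_nhds.sub
      ((Real.tendsto_one_add_div_pow_exp (lam * t)).inv₀ (Real.exp_pos _).ne'))
  have hRt : Tendsto (fun N : ℕ => (∑ x ∈ U, ∑ y ∈ W \ U, ω x y) *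
      (t / N + 2 * √(D * t * ((1 + (-(2 * k * t)) / N) ^ N)⁻¹))) atTop
      (𝓝 ((∑ x ∈ U, ∑ y ∈ W \ U, ω x y) * (0 + 2 * √(D * t * Real.exp (2 * k * t))))) := by
    refine Tendsto.const_mul _ ((tendsto_const_div_atTop_nhds_zero_nat t).add
      (Tendsto.const_mul _ ((Tendsto.const_mul _ ?_).sqrt)))
    have := (Real.tendsto_one_add_div_pow_exp (-(2 * k * t))).inv₀ (Real.exp_pos _).ne'
    rwa [Real.exp_neg, inv_inv] at this
  rw [zero_add] at hRt
  refine le_of_tendsto_of_tendsto hL hRt ?_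
  obtain ⟨N₀, hN₀⟩ := exists_nat_gt (2 * k * t)
  filter_upwards [eventually_ge_atTop (N₀ + 1)] with N hN
  have hN1 : (N₀ : ℝ) + 1 ≤ N := by exact_mod_cast hN
  have hNpos : (0 : ℝ) < N := by
    have : (0 : ℝ) ≤ N₀ := Nat.cast_nonneg _
    linarith
  have hτ : 0 < t / N := by positivity
  have hkτ : 2 * k * (t / N) < 1 := by
    rw [← mul_div_assoc, div_lt_one hNpos]
    linarith
  have h1 := main_est hm hnn hsymm hloc hA hlam hray hk hτ hkτ hD0 hD hCD U W hUW hW N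
  have e1 : lam * (t / N) = lam * t / N := by ring
  have e2 : 1 - 2 * k * (t / N) = 1 + (-(2 * k * t)) / N := by ring
  rw [e1] at h1
  refine le_trans h1 (le_of_eq ?_)
  congr 1
  have hq : 0 < (1 - 2 * k * (t / N)) ^ N := pow_pos (by linarith) N
  rw [← e2]
  set q := (1 - 2 * k * (t / N)) ^ N
  have e3 : D * t * q⁻¹ = (t / N) ^ 2 * (D / (t / N * q)) * N := by
    field_simp
  rw [e3, Real.sqrt_mul (by positivity), Real.sqrt_mul (by positivity), Real.sqrt_sq hτ.le]
  ring

/-- optimisation in `t` -/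
lemma final_est {lam h k D : ℝ} (hlam : 0 ≤ lam) (hh : 0 ≤ h) (hk : 0 ≤ k) (hD : 0 < D)
    (hmain : ∀ t > 0, 1 - Real.exp (-(lam * t)) ≤ h * (2 * √(D * t * Real.exp (2 * k * t)))) :
    lam ≤ max ((32 * D / (1 - Real.exp (-1)) ^ 2) * h ^ 2) ((32 * √D) * √k * h) := by
  have hexp1 : Real.exp (-1) < 1 := by
    rw [Real.exp_lt_one_iff]; norm_num
  have he : Real.exp 1 < 3 := lt_trans Real.exp_one_lt_d9 (by norm_num)
  rcases hlam.eq_or_lt with h0 | hpos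
  · rw [← h0]
    refine le_trans ?_ (le_max_right _ _)
    positivity
  rcases le_or_gt (2 * k) lam with hle | hlt
  · refine le_trans ?_ (le_max_left _ _)
    have h1 := hmain (1 / lam) (by positivity)
    rw [mul_one_div_cancel hpos.ne'] at h1
    have h2 : Real.exp (2 * k * (1 / lam)) ≤ 3 := by
      refine le_trans (Real.exp_le_exp.2 ?_) he.le
      rw [mul_one_div, div_le_one hpos]
      exact hle
    have h3 : √(D * (1 / lam) * Real.exp (2 * k * (1 / lam))) ≤ √(D * (1 / lam) * 3) :=
      Real.sqrt_le_sqrt (mul_le_mul_of_nonneg_left h2 (by positivity))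
    have h4 : 1 - Real.exp (-1) ≤ h * (2 * √(D * (1 / lam) * 3)) :=
      le_trans h1 (mul_le_mul_of_nonneg_left (by linarith) hh)
    have h5 : (1 - Real.exp (-1)) ^ 2 ≤ (h * (2 * √(D * (1 / lam) * 3))) ^ 2 :=
      pow_le_pow_left₀ (by linarith) h4 2
    rw [mul_pow, mul_pow, Real.sq_sqrt (by positivity)] at h5
    have h6 : 0 < (1 - Real.exp (-1)) ^ 2 := pow_pos (by linarith) 2
    rw [div_mul_eq_mul_div, le_div_iff₀ h6]
    have h7 := mul_le_mul_of_nonneg_left h5 hlam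
    have h8 : lam * (h ^ 2 * (2 ^ 2 * (D * (1 / lam) * 3))) = 12 * D * h ^ 2 := by
      field_simp
      ring
    rw [h8] at h7
    have : 0 ≤ D * h ^ 2 := by positivity
    linarith
  · refine le_trans ?_ (le_max_right _ _)
    have hk0 : 0 < k := by linarith
    have h1 := hmain (1 / (2 * k)) (by positivity)
    rw [mul_one_div_cancel (by positivity)] at h1
    have h3 : √(D * (1 / (2 * k)) * Real.exp 1) ≤ √(D * (1 / (2 * k)) * 3) :=
      Real.sqrt_le_sqrt (mul_le_mul_of_nonneg_left he.le (by positivity))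
    have h4 : √(D * (1 / (2 * k)) * 3) ≤ √(4 * (D * k / k ^ 2)) := by
      apply Real.sqrt_le_sqrt
      have : D * k / k ^ 2 = 2 * (D * (1 / (2 * k))) := by
        field_simp
      rw [this]
      have : 0 ≤ D * (1 / (2 * k)) := by positivity
      linarith
    have h5 : √(4 * (D * k / k ^ 2)) = 2 * (√D * √k) / k := by
      have : 4 * (D * k / k ^ 2) = (2 / k) ^ 2 * (D * k) := by
        field_simp
        norm_num
      rw [this, Real.sqrt_mul (by positivity), Real.sqrt_sq (by positivity),
        Real.sqrt_mul hD.le]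
      ring
    have h6 : lam / (4 * k) ≤ 1 - Real.exp (-(lam * (1 / (2 * k)))) := by
      set s := lam * (1 / (2 * k)) with hs
      have hs0 : 0 ≤ s := by positivity
      have hs1 : s ≤ 1 := by
        rw [hs, mul_one_div, div_le_one (by positivity)]
        exact hlt.le
      have e : lam / (4 * k) = s / 2 := by
        rw [hs]; field_simp; norm_num
      have hx := Real.add_one_le_exp s
      have h7 : Real.exp (-s) ≤ 1 / (s + 1) := by
        rw [Real.exp_neg, ← one_div]
        exact one_div_le_one_div_of_le (by linarith) hx
      have h8 : 1 / (s + 1) ≤ 1 - s / 2 := by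
        rw [div_le_iff₀ (by linarith)]
        nlinarith
      linarith
    have h9 : lam / (4 * k) ≤ h * (2 * (2 * (√D * √k) / k)) := by
      refine le_trans h6 (le_trans h1 (mul_le_mul_of_nonneg_left ?_ hh))
      linarith
    rw [div_le_iff₀ (by positivity)] at h9
    have e : h * (2 * (2 * (√D * √k) / k)) * (4 * k) = 16 * (√D * √k * h) := by
      field_simp
      ring
    rw [e] at h9
    have : 0 ≤ √D * √k * h := by positivity
    linarith

end BuserAux

/-- STATEMENT 10 (Buser's inequality on infinite graphs), with explicit constants
depending only on `Dω`. -/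
theorem buser_inequality {V : Type*} [Infinite V] (m : V → ℝ) (ω : V → V → ℝ)
    (hm : ∀ x, 0 < m x) (hnn : ∀ x y, 0 ≤ ω x y) (hsymm : ∀ x y, ω x y = ω y x)
    (hloc : LocallyFiniteGraph ω)
    (hconn : ∀ x y : V, Relation.ReflTransGen (fun a b => 0 < ω a b) x y)
    (K Dω : ℝ) (hDω : ∀ x y, ω x y ≠ 0 → m x ≤ Dω * ω x y)
    (hCD : ∀ (f : V → ℝ) (x : V), gam2Op m ω f x ≥ K * gamOp m ω f f x)
    (hA : AssumptionA m ω) :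
    sInf {r : ℝ | ∃ f : V → ℝ, (Function.support f).Finite ∧ f ≠ 0 ∧
        r = (∑' x, m x * f x * (- lapOp m ω f x)) / (∑' x, m x * f x * f x)}
      ≤ max
          ((32 * Dω / (1 - Real.exp (-1)) ^ 2)
            * (sInf {r : ℝ | ∃ U : Set V, U.Finite ∧ U.Nonempty ∧
                r = bdrySet ω U / volSet m U}) ^ 2)
          ((32 * Real.sqrt Dω) * Real.sqrt |K|
            * sInf {r : ℝ | ∃ U : Set V, U.Finite ∧ U.Nonempty ∧
                r = bdrySet ω U / volSet m U}) := by
  have hne := hconn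
  obtain ⟨x₀⟩ : Nonempty V := inferInstance
  obtain ⟨y₀, hy₀⟩ := exists_ne x₀
  have hD0 : 0 < Dω := by
    rcases Relation.ReflTransGen.cases_head (hconn x₀ y₀) with h | ⟨z, hz, _⟩
    · exact absurd h.symm hy₀
    · have h1 := hDω x₀ z hz.ne'
      have h2 := hm x₀
      by_contra hcon
      nlinarith
  set lam := sInf {r : ℝ | ∃ f : V → ℝ, (Function.support f).Finite ∧ f ≠ 0 ∧
        r = (∑' x, m x * f x * (- lapOp m ω f x)) / (∑' x, m x * f x * f x)} with hlamdef
  set h := sInf {r : ℝ | ∃ U : Set V, U.Finite ∧ U.Nonempty ∧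
                r = bdrySet ω U / volSet m U} with hhdef
  have hh0 : 0 ≤ h := by
    apply Real.sInf_nonneg
    rintro r ⟨U, hU, _, rfl⟩
    apply div_nonneg
    · exact tsum_nonneg fun x => Set.indicator_nonneg (fun x _ => tsum_nonneg fun y =>
        Set.indicator_nonneg (fun y _ => hnn x y) y) x
    · exact tsum_nonneg fun x => Set.indicator_nonneg (fun x _ => (hm x).le) x
  -- sums over finite supports
  have htsum1 : ∀ (Ω : Finset V) (f : V → ℝ), (∀ x, x ∉ Ω → f x = 0) →
      ∑' x, m x * f x * (- lapOp m ω f x) = ∑ x ∈ Ω, m x * f x * (- lapOp m ω f x) := by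
    intro Ω f hf
    exact tsum_eq_sum fun x hx => by simp [hf x hx]
  have htsum2 : ∀ (Ω : Finset V) (f : V → ℝ), (∀ x, x ∉ Ω → f x = 0) →
      ∑' x, m x * f x * f x = ∑ x ∈ Ω, m x * f x ^ 2 := by
    intro Ω f hf
    rw [tsum_eq_sum (s := Ω) fun x hx => by simp [hf x hx]]
    exact Finset.sum_congr rfl fun x _ => by ring
  have hset0 : ∀ r ∈ {r : ℝ | ∃ f : V → ℝ, (Function.support f).Finite ∧ f ≠ 0 ∧
        r = (∑' x, m x * f x * (- lapOp m ω f x)) / (∑' x, m x * f x * f x)}, 0 ≤ r := by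
    rintro r ⟨f, hf, _, rfl⟩
    have hf' : ∀ x, x ∉ hf.toFinset → f x = 0 := by
      intro x hx
      by_contra hne
      exact hx (by simpa using hne)
    rw [htsum1 _ f hf', htsum2 _ f hf']
    apply div_nonneg
    · have := BuserAux.energy hm hnn hsymm hloc _ f hf' ∅
      simpa using this
    · exact Finset.sum_nonneg fun x _ => mul_nonneg (hm x).le (sq_nonneg _)
  have hlam0 : 0 ≤ lam := Real.sInf_nonneg hset0
  have hray : ∀ (Ω : Finset V) (v : V → ℝ), (∀ x, x ∉ Ω → v x = 0) →
      lam * ∑ x ∈ Ω, m x * v x ^ 2 ≤ ∑ x ∈ Ω, m x * v x * (- lapOp m ω v x) := by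
    intro Ω v hv
    by_cases hv0 : v = 0
    · simp [hv0]
    · have hpos : 0 < ∑ x ∈ Ω, m x * v x ^ 2 := by
        obtain ⟨z, hz⟩ := Function.ne_iff.1 hv0
        have hz' : v z ≠ 0 := hz
        have hzΩ : z ∈ Ω := by
          by_contra hcon
          exact hz' (hv z hcon)
        refine Finset.sum_pos' (fun x _ => mul_nonneg (hm x).le (sq_nonneg _)) ⟨z, hzΩ, ?_⟩
        have := hm z
        positivity
      rw [← le_div_iff₀ hpos]
      refine csInf_le ⟨0, hset0⟩ ⟨v, ?_, hv0, ?_⟩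
      · apply Ω.finite_toSet.subset
        intro x hx
        by_contra hcon
        exact hx (hv x hcon)
      · rw [htsum1 Ω v hv, htsum2 Ω v hv]
  have hCD' : ∀ (f : V → ℝ) (x : V), gam2Op m ω f x ≥ - |K| * gamOp m ω f f x := by
    intro f x
    have h1 := hCD f x
    have h2 := mul_le_mul_of_nonneg_right (neg_abs_le K) (BuserAux.gam_nonneg hm hnn hloc f x)
    linarith
  -- the inequality for every set and time
  have hmain : ∀ t > 0, 1 - Real.exp (-(lam * t)) ≤
      h * (2 * √(Dω * t * Real.exp (2 * |K| * t))) := by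
    intro t ht
    have hR : 0 < 2 * √(Dω * t * Real.exp (2 * |K| * t)) := by
      have := Real.exp_pos (2 * |K| * t)
      have : 0 < √(Dω * t * Real.exp (2 * |K| * t)) := Real.sqrt_pos.2 (by positivity)
      linarith
    rw [← div_le_iff₀ hR]
    refine le_csInf ⟨_, {x₀}, Set.finite_singleton x₀, Set.singleton_nonempty x₀, rfl⟩ ?_
    rintro r ⟨U, hUf, hUn, rfl⟩
    classical
    obtain ⟨W, hUW, hW⟩ := BuserAux.exists_nbs hloc hUf.toFinset
    have hvol : volSet m U = ∑ x ∈ hUf.toFinset, m x := by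
      unfold volSet
      rw [tsum_eq_sum (s := hUf.toFinset) fun x hx => by
        simp only [Set.Finite.mem_toFinset] at hx
        simp [hx]]
      refine Finset.sum_congr rfl fun x hx => ?_
      simp only [Set.Finite.mem_toFinset] at hx
      simp [hx]
    have hbd : bdrySet ω U = ∑ x ∈ hUf.toFinset, ∑ y ∈ W \ hUf.toFinset, ω x y := by
      unfold bdrySet
      rw [tsum_eq_sum (s := hUf.toFinset) fun x hx => by
        simp only [Set.Finite.mem_toFinset] at hx
        simp [hx]]
      refine Finset.sum_congr rfl fun x hx => ?_
      have hxU : x ∈ U := by simpa using hx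
      rw [Set.indicator_of_mem hxU]
      rw [tsum_eq_sum (s := W \ hUf.toFinset) fun y hy => by
        by_cases hyU : y ∈ U
        · simp [hyU]
        · have : ω x y = 0 := by
            by_contra hcon
            exact hy (Finset.mem_sdiff.2 ⟨hW x hx y hcon, by simpa using hyU⟩)
          simp [this]]
      refine Finset.sum_congr rfl fun y hy => ?_
      have hyU : y ∉ U := by simpa using (Finset.mem_sdiff.1 hy).2
      simp [hyU]
    have hvpos : 0 < volSet m U := by
      rw [hvol]
      exact Finset.sum_pos (fun x _ => hm x) (by simpa using hUn)
    rw [div_le_div_iff₀ hR hvpos, mul_comm, hvol, hbd]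
    exact BuserAux.limit_est hm hnn hsymm hloc hA hlam0 hray (abs_nonneg K) ht hD0 hDω hCD'
      hUf.toFinset W hUW hW
  exact BuserAux.final_est hlam0 hh0 (abs_nonneg K) hD0 hmain
end

section
/- (Finiteness under positive curvature) Let G=(V,E,m,ω) be a weighted graph satisfying assumption (A) and CD(n,K) with K > 0. Then the total measure |V| = Σ_{x∈V} m(x) is finite. In particular, if inf_x m(x) = δ > 0, the vertex set V is finite. -/
open Real Filter Topology
open scoped BigOperators

section helpers
variable {V : Type*}

lemma fm_tsum (ω : V → V → ℝ) (hloc : LocallyFiniteGraph ω) (x : V) (h : V → ℝ) :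
    ∑' y, ω x y * h y = ∑ y ∈ (hloc x).toFinset, ω x y * h y := by
  apply tsum_eq_sum
  intro y hy
  have : ω x y = 0 := by simpa using hy
  simp [this]

lemma fm_lap (m : V → ℝ) (ω : V → V → ℝ) (hloc : LocallyFiniteGraph ω) (f : V → ℝ) (x : V) :
    lapOp m ω f x = (1 / m x) * ∑ y ∈ (hloc x).toFinset, ω x y * (f y - f x) := by
  unfold lapOp
  rw [fm_tsum ω hloc x (fun y => f y - f x)]

lemma fm_gam (m : V → ℝ) (ω : V → V → ℝ) (hloc : LocallyFiniteGraph ω) (f g : V → ℝ) (x : V) :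
    gamOp m ω f g x =
      (1 / (2 * m x)) * ∑ y ∈ (hloc x).toFinset, ω x y * ((f y - f x) * (g y - g x)) := by
  unfold gamOp
  rw [← fm_tsum ω hloc x (fun y => (f y - f x) * (g y - g x))]
  simp only [mul_assoc]

lemma fm_deg (ω : V → V → ℝ) (hloc : LocallyFiniteGraph ω) (x : V) :
    ∑' y, ω x y = ∑ y ∈ (hloc x).toFinset, ω x y := by
  simpa using fm_tsum ω hloc x (fun _ => 1)

/-- The Hilbert space of vertex and edge functions. -/
abbrev FmH (V : Type*) := lp (fun _ : V ⊕ (V × V) => ℝ) 2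

/-- Evaluation at a coordinate. -/
noncomputable def fmE (i : V ⊕ (V × V)) : FmH V →L[ℝ] ℝ :=
  lp.evalCLM ℝ (fun _ : V ⊕ (V × V) => ℝ) 2 i

lemma fmE_single [DecidableEq V] (i j : V ⊕ (V × V)) (a : ℝ) :
    fmE j (lp.single 2 i a : FmH V) = if j = i then a else 0 := by
  change (lp.single 2 i a : FmH V) j = _
  rw [lp.single_apply, Pi.single_apply]

lemma fmE_inner [DecidableEq V] (i : V ⊕ (V × V)) (a : ℝ) (g : FmH V) :
    inner ℝ (lp.single 2 i a : FmH V) g = a * fmE i g := by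
  rw [lp.inner_single_left]
  change fmE i g * a = _
  ring

lemma fmE_hasSum (g : FmH V) : HasSum (fun i => (fmE i g) ^ 2) (‖g‖ ^ 2) := by
  have := lp.hasSum_norm (p := 2) (by norm_num) g
  have h2 : HasSum (fun i => ‖fmE i g‖ ^ (2:ENNReal).toReal) (‖g‖ ^ (2:ENNReal).toReal) := this
  simpa using h2

lemma fm_resolvent (m : V → ℝ) (ω : V → V → ℝ)
    (hm : ∀ x, 0 < m x) (hnn : ∀ x y, 0 ≤ ω x y) (hsymm : ∀ x y, ω x y = ω y x)
    (hloc : LocallyFiniteGraph ω) (η : V → ℝ) (hη : (Function.support η).Finite) :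
    ∃ A : ℝ, 0 ≤ A ∧ ∀ α : ℝ, 0 < α → ∃ u : V → ℝ,
      (∀ x, lapOp m ω u x = α * (u x - η x)) ∧
      Summable (fun p : V × V => ω p.1 p.2 * (u p.2 - u p.1) ^ 2) ∧
      (∀ x y, ω x y * (u y - u x) ^ 2 ≤ 2 * α * A) ∧
      (∀ S : Finset V, ∑ x ∈ S, m x * u x ^ 2 ≤ A) := by
  classical
  have hsum : ∀ g : FmH V, HasSum (fun i => (fmE i g) ^ 2) (‖g‖ ^ 2) := fmE_hasSum
  have hvec : Memℓp (fun i : V ⊕ (V × V) => Sum.elim (fun x => √(m x) * η x) (fun _ => (0:ℝ)) i) 2 := by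
    apply memℓp_gen
    apply summable_of_hasFiniteSupport
    refine (hη.image Sum.inl).subset ?_
    intro i hi
    rcases i with x | p
    · refine ⟨x, ?_, rfl⟩
      intro h
      apply hi
      simp [h]
    · exfalso; apply hi; simp
  let vec : FmH V := ⟨_, hvec⟩
  refine ⟨‖vec‖ ^ 2, by positivity, ?_⟩
  intro α hα
  let c : V → V → ℝ := fun a b => √(ω a b / (2 * α))
  have hc2 : ∀ a b, c a b * c a b = ω a b / (2 * α) := fun a b =>
    Real.mul_self_sqrt (div_nonneg (hnn a b) (by positivity))
  have hcs : ∀ a b, c a b = c b a := fun a b => by simp only [c, hsymm a b]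
  have hsm : ∀ x, 0 < √(m x) := fun x => Real.sqrt_pos.2 (hm x)
  have hsm2 : ∀ x, √(m x) * √(m x) = m x := fun x => Real.mul_self_sqrt (hm x).le
  let W : Submodule ℝ (FmH V) :=
    { carrier := {g | ∀ a b, fmE (Sum.inr (a, b)) g =
        c a b * (fmE (Sum.inl b) g / √(m b) - fmE (Sum.inl a) g / √(m a))}
      add_mem' := by
        intro f g hf hg a b
        have h1 := hf a b
        have h2 := hg a b
        rw [map_add, map_add, map_add]
        rw [h1, h2]; ring
      zero_mem' := by
        intro a b
        simp
      smul_mem' := by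
        intro r g hg a b
        have h1 := hg a b
        rw [map_smul, map_smul, map_smul]; simp only [smul_eq_mul]
        rw [h1]; ring }
  have hev : ∀ i, Continuous (fun g : FmH V => fmE i g) := fun i =>
    (fmE i).continuous
  have hWc : IsClosed (W : Set (FmH V)) := by
    have : (W : Set (FmH V)) = ⋂ a, ⋂ b, {g : FmH V | fmE (Sum.inr (a, b)) g =
        c a b * (fmE (Sum.inl b) g / √(m b) - fmE (Sum.inl a) g / √(m a))} := by
      ext g
      simp only [Set.mem_iInter, Set.mem_ofPred_eq]
      exact Iff.rfl
    rw [this]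
    refine isClosed_iInter fun a => isClosed_iInter fun b => isClosed_eq (hev _) ?_
    exact continuous_const.mul (((hev _).div_const _).sub ((hev _).div_const _))
  have : CompleteSpace W := hWc.completeSpace_coe
  let p : FmH V := W.starProjection vec
  have hpW : p ∈ W := W.starProjection_apply_mem vec
  have hpn : ‖p‖ ^ 2 ≤ ‖vec‖ ^ 2 :=
    pow_le_pow_left₀ (norm_nonneg _) (W.norm_starProjection_apply_le vec) 2
  have hp : ∀ a b, fmE (Sum.inr (a, b)) p =
        c a b * (fmE (Sum.inl b) p / √(m b) - fmE (Sum.inl a) p / √(m a)) := hpW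
  let u : V → ℝ := fun x => fmE (Sum.inl x) p / √(m x)
  have hpl : ∀ x, fmE (Sum.inl x) p = √(m x) * u x := fun x => by
    simp only [u]; rw [mul_div_cancel₀ _ (hsm x).ne']
  have hp' : ∀ a b, fmE (Sum.inr (a, b)) p = c a b * (u b - u a) := hp
  have hp2 : ∀ a b, fmE (Sum.inr (a, b)) p ^ 2 = ω a b / (2 * α) * (u b - u a) ^ 2 := fun a b => by
    rw [hp', mul_pow, sq (c a b), hc2]
  refine ⟨u, ?_, ?_, ?_, ?_⟩
  · intro x
    let v : FmH V := lp.single 2 (Sum.inl x) (√(m x)) + ∑ y ∈ (hloc x).toFinset,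
      (lp.single 2 (Sum.inr (y, x)) (c x y) - lp.single 2 (Sum.inr (x, y)) (c x y))
    have hvl : ∀ b, fmE (Sum.inl b) v = if b = x then √(m x) else 0 := by
      intro b
      simp only [v, map_add, map_sum, map_sub, fmE_single]
      simp
    have hc0 : ∀ b, b ∉ (hloc x).toFinset → c x b = 0 := by
      intro b hb
      have : ω x b = 0 := by simpa using hb
      simp [c, this]
    have hvr : ∀ a b, fmE (Sum.inr (a, b)) v =
        (if b = x then c x a else 0) - (if a = x then c x b else 0) := by
      intro a b
      simp only [v, map_add, map_sum, map_sub, fmE_single, Finset.sum_sub_distrib]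
      have h1 : ∑ y ∈ (hloc x).toFinset, (if (Sum.inr (a, b) : V ⊕ (V × V)) = Sum.inr (y, x) then c x y else 0)
          = if b = x then c x a else 0 := by
        by_cases hb : b = x
        · subst hb
          simp only [Sum.inr.injEq, Prod.mk.injEq, and_true, if_true]
          rw [Finset.sum_ite_eq]
          split_ifs with h
          · rfl
          · exact (hc0 a h).symm
        · simp [hb]
      have h2 : ∑ y ∈ (hloc x).toFinset, (if (Sum.inr (a, b) : V ⊕ (V × V)) = Sum.inr (x, y) then c x y else 0)
          = if a = x then c x b else 0 := by
        by_cases hb : a = x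
        · subst hb
          simp only [Sum.inr.injEq, Prod.mk.injEq, true_and, if_true]
          rw [Finset.sum_ite_eq]
          split_ifs with h
          · rfl
          · exact (hc0 b h).symm
        · simp [hb]
      rw [h1, h2]
      simp
    have hvW : v ∈ W := by
      intro a b
      rw [hvr, hvl, hvl]
      by_cases ha : a = x <;> by_cases hb : b = x
      · simp [ha, hb]
      · simp [ha, hb, (hsm x).ne']
      · simp [ha, hb, (hsm x).ne', hcs a x]
      · simp [ha, hb]
    have h0 := W.starProjection_inner_eq_zero vec v hvW
    rw [real_inner_comm] at h0
    simp only [v, inner_add_left, sum_inner, inner_sub_left, fmE_inner] at h0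
    have e1 : ∀ i, fmE i (vec - W.starProjection vec) = fmE i vec - fmE i p := fun i => map_sub _ _ _
    have e2 : ∀ q, fmE (Sum.inr q) vec = 0 := fun q => rfl
    have e3 : ∀ y, fmE (Sum.inl y) vec = √(m y) * η y := fun y => rfl
    simp only [e1, e2, e3, hpl, hp'] at h0
    rw [fm_lap m ω hloc]
    have e4 : ∀ y ∈ (hloc x).toFinset, c x y * (0 - c y x * (u x - u y)) - c x y * (0 - c x y * (u y - u x))
        = (1 / α) * (ω x y * (u y - u x)) := by
      intro y _
      rw [hcs y x]
      have := hc2 x y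
      have h3 : c x y * (0 - c x y * (u x - u y)) - c x y * (0 - c x y * (u y - u x))
        = 2 * (c x y * c x y) * (u y - u x) := by ring
      rw [h3, this]
      field_simp
    rw [Finset.sum_congr rfl e4, ← Finset.mul_sum] at h0
    have e5 : √(m x) * (√(m x) * η x - √(m x) * u x) = m x * (η x - u x) := by
      linear_combination (η x - u x) * hsm2 x
    rw [e5] at h0
    have := hm x
    field_simp at h0 ⊢
    linarith
  · have h1 := (hsum p).summable.comp_injective (Sum.inr_injective (α := V) (β := V × V))
    have h2 := h1.mul_left (2 * α)
    refine h2.congr ?_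
    rintro ⟨a, b⟩
    simp only [Function.comp, hp2]
    field_simp
  · intro x y
    have h1 := le_hasSum (hsum p) (Sum.inr (x, y)) (fun j _ => sq_nonneg _)
    rw [hp2] at h1
    have h2 := h1.trans hpn
    rw [div_mul_eq_mul_div, div_le_iff₀ (by positivity)] at h2
    linarith
  · intro S
    have h1 := sum_le_hasSum (S.map ⟨Sum.inl, Sum.inl_injective⟩) (fun j _ => sq_nonneg _) (hsum p)
    rw [Finset.sum_map] at h1
    refine le_trans (le_of_eq ?_) (h1.trans hpn)
    refine Finset.sum_congr rfl fun x _ => ?_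
    simp only [Function.Embedding.coeFn_mk, hpl, mul_pow, sq (√(m x)), hsm2]


/-- Maximum principle: a nonnegative `v` with `Δ v ≥ K v`, `∑ m v < ∞`, `∑ deg v < ∞` vanishes. -/
lemma fm_max (m : V → ℝ) (ω : V → V → ℝ)
    (hm : ∀ x, 0 < m x) (hnn : ∀ x y, 0 ≤ ω x y) (hsymm : ∀ x y, ω x y = ω y x)
    (hloc : LocallyFiniteGraph ω) (K : ℝ) (hK : 0 < K) (v : V → ℝ) (hv : ∀ x, 0 ≤ v x)
    (hmv : Summable fun x => m x * v x)
    (hdv : Summable fun x => (∑' y, ω x y) * v x)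
    (hL : ∀ x, K * v x ≤ lapOp m ω v x) (x : V) : v x = 0 := by
  have hs : ∀ a (h : V → ℝ), Summable fun y => ω a y * h y := by
    intro a h
    apply summable_of_hasFiniteSupport
    refine (hloc a).subset ?_
    intro y hy h0
    apply hy
    have : ω a y = 0 := h0
    simp [this]
  have hF : Summable (fun p : V × V => ω p.1 p.2 * v p.1) := by
    rw [summable_prod_of_nonneg (fun p => mul_nonneg (hnn _ _) (hv _))]
    refine ⟨fun a => hs a (fun _ => v a), ?_⟩
    simpa [tsum_mul_right] using hdv
  have hG : Summable (fun p : V × V => ω p.1 p.2 * v p.2) := by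
    have := (Equiv.prodComm V V).summable_iff.2 hF
    refine this.congr ?_
    rintro ⟨a, b⟩
    simp [hsymm a b]
  have hFG : ∑' p : V × V, ω p.1 p.2 * v p.2 = ∑' p : V × V, ω p.1 p.2 * v p.1 := by
    rw [← (Equiv.prodComm V V).tsum_eq]
    refine tsum_congr ?_
    rintro ⟨a, b⟩
    simp [hsymm a b]
  have hsub := hG.sub hF
  have h0 : ∑' p : V × V, (ω p.1 p.2 * v p.2 - ω p.1 p.2 * v p.1) = 0 := by
    rw [hG.tsum_sub hF, hFG, sub_self]
  rw [hsub.tsum_prod] at h0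
  have hpt : ∀ a, K * (m a * v a) ≤ ∑' b, (ω a b * v b - ω a b * v a) := by
    intro a
    have h1 := hL a
    unfold lapOp at h1
    have h2 : ∑' y, ω a y * (v y - v a) = ∑' b, (ω a b * v b - ω a b * v a) :=
      tsum_congr fun b => by ring
    rw [h2] at h1
    have := hm a
    rw [one_div, inv_mul_eq_div, le_div_iff₀ this] at h1
    linarith
  have hle : ∑' a, K * (m a * v a) ≤ 0 := by
    rw [← h0]
    exact (hmv.mul_left K).tsum_le_tsum hpt hsub.prod
  have h1 := (hmv.mul_left K).le_tsum x (fun j _ =>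
    mul_nonneg hK.le (mul_nonneg (hm j).le (hv j)))
  have h2 : K * (m x * v x) ≤ 0 := h1.trans hle
  have h3 := hv x
  have h4 : 0 < K * m x := mul_pos hK (hm x)
  by_contra hne
  have : 0 < v x := lt_of_le_of_ne h3 (Ne.symm hne)
  have := mul_pos h4 this
  nlinarith

/-- Finite support cutoffs with small gradient. -/
lemma fm_cutoff (m : V → ℝ) (ω : V → V → ℝ)
    (hm : ∀ x, 0 < m x) (hnn : ∀ x y, 0 ≤ ω x y)
    (hsymm : ∀ x y, ω x y = ω y x) (hloc : LocallyFiniteGraph ω) (hA : AssumptionA m ω) (x0 : V) (e : ℝ) (he : 0 < e) :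
    ∃ η : V → ℝ, (Function.support η).Finite ∧ (∀ x, gamOp m ω η η x ≤ e) ∧ 1 / 2 ≤ η x0 := by
  classical
  rcases hA with ⟨C, hC⟩ | ⟨⟨η, hfin, -, hlim, hg⟩, -⟩
  · let B : ℕ → Finset V := fun n => Nat.rec (motive := fun _ => Finset V) {x0}
      (fun _ S => S ∪ S.biUnion fun x => (hloc x).toFinset) n
    have hB0 : B 0 = {x0} := rfl
    have hBs : ∀ i, B (i + 1) = B i ∪ (B i).biUnion fun x => (hloc x).toFinset := fun i => rfl
    have hx0 : ∀ i, x0 ∈ B i := by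
      intro i
      induction i with
      | zero => simp [hB0]
      | succ i ih => rw [hBs]; exact Finset.mem_union_left _ ih
    have hnb : ∀ i x y, ω x y ≠ 0 → x ∈ B i → y ∈ B (i + 1) := by
      intro i x y hxy hx
      rw [hBs]
      refine Finset.mem_union_right _ (Finset.mem_biUnion.2 ⟨x, hx, ?_⟩)
      simpa using hxy
    obtain ⟨R, hR⟩ := exists_nat_gt (max 1 (|C| / e))
    have hR1 : (1 : ℝ) < R := lt_of_le_of_lt (le_max_left _ _) hR
    have hR2 : |C| / e < R := lt_of_le_of_lt (le_max_right _ _) hR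
    have hR0 : (0 : ℝ) < R := by linarith
    let cnt : V → ℝ := fun x => ∑ i ∈ Finset.range R, if x ∈ B i then (1 : ℝ) else 0
    have hcnt : ∀ x y, (∀ i, x ∈ B i → y ∈ B (i + 1)) → cnt x ≤ cnt y + 1 := by
      intro x y hxy
      have h1 : cnt x ≤ ∑ i ∈ Finset.range R, if y ∈ B (i + 1) then (1 : ℝ) else 0 := by
        refine Finset.sum_le_sum fun i _ => ?_
        by_cases hx : x ∈ B i
        · simp [hx, hxy i hx]
        · rw [if_neg hx]; positivity
      have h2 := Finset.sum_range_succ (fun i : ℕ => if y ∈ B i then (1 : ℝ) else 0) R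
      have h3 := Finset.sum_range_succ' (fun i : ℕ => if y ∈ B i then (1 : ℝ) else 0) R
      have h4 : (0 : ℝ) ≤ if y ∈ B 0 then (1 : ℝ) else 0 := by positivity
      have h5 : (if y ∈ B R then (1 : ℝ) else 0) ≤ 1 := by split_ifs <;> norm_num
      simp only [cnt] at *
      linarith
    have hsq : ∀ x y, ω x y ≠ 0 → (cnt y - cnt x) ^ 2 ≤ 1 := by
      intro x y h1
      have h2 : ω y x ≠ 0 := by rwa [← hsymm x y]
      have a1 := hcnt x y (fun i => hnb i x y h1)
      have a2 := hcnt y x (fun i => hnb i y x h2)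
      nlinarith
    refine ⟨fun x => cnt x / R, ?_, ?_, ?_⟩
    · refine (((Finset.range R).biUnion B).finite_toSet).subset ?_
      intro x hx
      by_contra hx2
      apply hx
      have : cnt x = 0 := by
        refine Finset.sum_eq_zero fun i hi => ?_
        have h : x ∉ B i := fun h => hx2 (by simpa using ⟨i, by simpa using hi, h⟩)
        exact if_neg h
      simp [this]
    · intro x
      rw [fm_gam m ω hloc]
      have h1 : ∑ y ∈ (hloc x).toFinset, ω x y * ((cnt y / R - cnt x / R) * (cnt y / R - cnt x / R))
          ≤ ∑ y ∈ (hloc x).toFinset, ω x y * (1 / R ^ 2) := by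
        refine Finset.sum_le_sum fun y hy => mul_le_mul_of_nonneg_left ?_ (hnn x y)
        have h2 := hsq x y (by simpa using hy)
        have h3 : (cnt y / R - cnt x / R) * (cnt y / R - cnt x / R) = (cnt y - cnt x) ^ 2 / R ^ 2 := by
          field_simp
        rw [h3]
        gcongr
      rw [← Finset.sum_mul, ← fm_deg ω hloc x] at h1
      have h4 : ∑' y, ω x y ≤ |C| * m x := by
        have := hC x
        rw [div_le_iff₀ (hm x)] at this
        exact this.trans (mul_le_mul_of_nonneg_right (le_abs_self C) (hm x).le)
      have hmx := hm x
      have h5 : (1 / (2 * m x)) * ((∑' y, ω x y) * (1 / R ^ 2))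
          ≤ (1 / (2 * m x)) * ((|C| * m x) * (1 / R ^ 2)) := by
        gcongr
      refine (mul_le_mul_of_nonneg_left h1 (by positivity)).trans (h5.trans ?_)
      have h6 : (1 / (2 * m x)) * ((|C| * m x) * (1 / R ^ 2)) = |C| / (2 * R ^ 2) := by
        field_simp
      rw [h6, div_le_iff₀ (by positivity)]
      rw [div_lt_iff₀ he] at hR2
      have h7 : (R : ℝ) * e ≤ e * (2 * R ^ 2) := by
        have : (R : ℝ) ≤ 2 * R ^ 2 := by nlinarith
        nlinarith
      linarith
    · have : cnt x0 = R := by simp [cnt, hx0]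
      simp only [this]
      rw [div_self hR0.ne']
      norm_num
  · have h1 : ∀ᶠ k in atTop, 1 / 2 ≤ η k x0 :=
      (hlim x0).eventually_const_le (by norm_num)
    obtain ⟨N, hN⟩ := exists_nat_gt (1 / e)
    obtain ⟨k, hk1, hk2⟩ := (h1.and (eventually_ge_atTop (max N 1))).exists
    refine ⟨η k, hfin k, fun x => (hg k (le_trans (le_max_right _ _) hk2) x).trans ?_, hk1⟩
    have hNk : (N : ℝ) ≤ k := by exact_mod_cast le_trans (le_max_left _ _) hk2
    have hk : 1 / e < k := lt_of_lt_of_le hN hNk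
    have hk0 : (0 : ℝ) < k := lt_trans (by positivity) hk
    rw [div_lt_iff₀ he] at hk
    rw [div_le_iff₀ hk0]
    linarith

/-- Gradient estimate for the resolvent. -/
lemma fm_grad (m : V → ℝ) (ω : V → V → ℝ)
    (hm : ∀ x, 0 < m x) (hnn : ∀ x y, 0 ≤ ω x y) (hsymm : ∀ x y, ω x y = ω y x)
    (hloc : LocallyFiniteGraph ω)
    (n K : ℝ) (hn : 0 < n) (hK : 0 < K)
    (hCD : ∀ (f : V → ℝ) (x : V),
      gam2Op m ω f x ≥ (1 / n) * (lapOp m ω f x) ^ 2 + K * gamOp m ω f f x)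
    (hA : AssumptionA m ω) (η u : V → ℝ) (e α : ℝ) (he : 0 < e) (hα : 0 < α)
    (hη : ∀ x, gamOp m ω η η x ≤ e)
    (hu : ∀ x, lapOp m ω u x = α * (u x - η x))
    (hs : Summable (fun p : V × V => ω p.1 p.2 * (u p.2 - u p.1) ^ 2)) (x : V) :
    gamOp m ω u u x ≤ α ^ 2 * e / K ^ 2 := by
  set w : V → ℝ := fun z => gamOp m ω u u z with hw
  set c : ℝ := α ^ 2 * e / K ^ 2 with hc
  have hc0 : 0 < c := by positivity
  have hw0 : ∀ z, 0 ≤ w z := by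
    intro z
    simp only [hw, fm_gam m ω hloc]
    have := hm z
    exact mul_nonneg (by positivity)
      (Finset.sum_nonneg fun y _ => mul_nonneg (hnn z y) (mul_self_nonneg _))
  have hmw : Summable fun z => m z * w z := by
    refine (hs.prod.mul_left (1 / 2)).congr fun z => ?_
    simp only [hw]
    rw [fm_gam m ω hloc, fm_tsum ω hloc z (fun y => (u y - u z) ^ 2)]
    have := hm z
    simp only [sq]
    field_simp
  have hgl : ∀ z, gamOp m ω u (lapOp m ω u) z = α * w z - α * gamOp m ω u η z := by
    intro z
    simp only [hw, fm_gam m ω hloc, hu]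
    rw [mul_left_comm α, mul_left_comm α, ← mul_sub, Finset.mul_sum _ _ α, Finset.mul_sum _ _ α,
      ← Finset.sum_sub_distrib]
    congr 1
    refine Finset.sum_congr rfl fun y _ => ?_
    ring
  have hcs : ∀ z, α * gamOp m ω u η z ≤ K / 2 * w z + α ^ 2 / (2 * K) * gamOp m ω η η z := by
    intro z
    simp only [hw, fm_gam m ω hloc]
    rw [mul_left_comm α, mul_left_comm (K / 2), mul_left_comm (α ^ 2 / (2 * K)), ← mul_add,
      Finset.mul_sum _ _ α, Finset.mul_sum _ _ (K / 2),
      Finset.mul_sum _ _ (α ^ 2 / (2 * K)), ← Finset.sum_add_distrib]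
    have := hm z
    refine mul_le_mul_of_nonneg_left ?_ (by positivity)
    refine Finset.sum_le_sum fun y _ => ?_
    have h1 : K / 2 * (ω z y * ((u y - u z) * (u y - u z))) +
        α ^ 2 / (2 * K) * (ω z y * ((η y - η z) * (η y - η z))) -
        α * (ω z y * ((u y - u z) * (η y - η z))) =
        ω z y * ((K * (u y - u z) - α * (η y - η z)) ^ 2 / (2 * K)) := by
      field_simp
      ring
    have h2 : 0 ≤ ω z y * ((K * (u y - u z) - α * (η y - η z)) ^ 2 / (2 * K)) :=
      mul_nonneg (hnn z y) (by positivity)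
    linarith
  have hLw : ∀ z, K * (w z - c) ≤ lapOp m ω w z := by
    intro z
    have h1 := hCD u z
    unfold gam2Op at h1
    rw [hgl z] at h1
    change (1 / 2) * lapOp m ω w z - _ ≥ _ + K * w z at h1
    have h2 : 0 ≤ (1 / n) * (lapOp m ω u z) ^ 2 := by positivity
    have h3 := hcs z
    have h4 : α ^ 2 / (2 * K) * gamOp m ω η η z ≤ α ^ 2 / (2 * K) * e :=
      mul_le_mul_of_nonneg_left (hη z) (by positivity)
    have h5 : α ^ 2 / (2 * K) * e = K * c / 2 := by
      rw [hc]; field_simp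
    have h6 := mul_nonneg hα.le (hw0 z)
    linarith
  let v : V → ℝ := fun z => max (w z - c) 0
  have hv0 : ∀ z, 0 ≤ v z := fun z => le_max_right _ _
  have hvw : ∀ z, v z ≤ w z := fun z => max_le (by linarith) (hw0 z)
  have hLv : ∀ z, K * v z ≤ lapOp m ω v z := by
    intro z
    have hmz := hm z
    by_cases hz : w z ≤ c
    · have h1 : v z = 0 := max_eq_right (by linarith)
      rw [fm_lap m ω hloc, h1, mul_zero]
      refine mul_nonneg (by positivity) (Finset.sum_nonneg fun y _ => mul_nonneg (hnn z y) ?_)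
      simpa using hv0 y
    · have h1 : v z = w z - c := max_eq_left (by linarith)
      rw [h1]
      refine (hLw z).trans ?_
      rw [fm_lap m ω hloc, fm_lap m ω hloc, h1]
      refine mul_le_mul_of_nonneg_left ?_ (by positivity)
      refine Finset.sum_le_sum fun y _ => mul_le_mul_of_nonneg_left ?_ (hnn z y)
      have : w y - c ≤ v y := le_max_left _ _
      linarith
  have hmv : Summable fun z => m z * v z :=
    Summable.of_nonneg_of_le (fun z => mul_nonneg (hm z).le (hv0 z))
      (fun z => mul_le_mul_of_nonneg_left (hvw z) (hm z).le) hmw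
  have hdv : Summable fun z => (∑' y, ω z y) * v z := by
    rcases hA with ⟨C, hC⟩ | ⟨-, δ, hδ, hδm⟩
    · refine Summable.of_nonneg_of_le (fun z => mul_nonneg (tsum_nonneg (hnn z)) (hv0 z))
        (fun z => ?_) (hmv.mul_left C)
      have := hC z
      rw [div_le_iff₀ (hm z)] at this
      rw [← mul_assoc]
      exact mul_le_mul_of_nonneg_right this (hv0 z)
    · apply summable_of_hasFiniteSupport
      have h1 : ∀ᶠ z in cofinite, m z * w z < δ * c :=
        hmw.tendsto_cofinite_zero.eventually_lt_const (by positivity)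
      rw [eventually_cofinite] at h1
      refine Set.Finite.subset h1 ?_
      intro z hz h2
      apply hz
      have h3 : w z ≤ c := by
        by_contra h4
        push Not at h4
        have := mul_le_mul (hδm z) h4.le hc0.le (hm z).le
        linarith
      have h4 : v z = 0 := max_eq_right (by linarith)
      simp [h4]
  have h0 := fm_max m ω hm hnn hsymm hloc K hK v hv0 hmv hdv hLv x
  have h1 : w x - c ≤ v x := le_max_left _ _
  have h2 : w x ≤ c := by linarith
  exact h2

end helpers

/-- finiteness of the measure under positive curvature. -/
theorem finite_measure_of_positive_curvature {V : Type*} (m : V → ℝ) (ω : V → V → ℝ)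
    (hm : ∀ x, 0 < m x) (hnn : ∀ x y, 0 ≤ ω x y) (hsymm : ∀ x y, ω x y = ω y x)
    (hloc : LocallyFiniteGraph ω)
    (hconn : ∀ x y : V, Relation.ReflTransGen (fun a b => 0 < ω a b) x y)
    (n K : ℝ) (hn : 0 < n) (hK : 0 < K)
    (hCD : ∀ (f : V → ℝ) (x : V),
      gam2Op m ω f x ≥ (1 / n) * (lapOp m ω f x) ^ 2 + K * gamOp m ω f f x)
    (hA : AssumptionA m ω) :
    Summable m ∧ ((∃ δ : ℝ, 0 < δ ∧ ∀ x, δ ≤ m x) → Finite V) := by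
  classical
  have hS : Summable m := by
    rcases isEmpty_or_nonempty V with hV | ⟨⟨x0⟩⟩
    · exact summable_empty
    set d : ℝ := ∑' y, ω x0 y with hd
    have hd0 : 0 ≤ d := tsum_nonneg (hnn x0)
    have hm0 := hm x0
    set e : ℝ := m x0 * K ^ 2 / (32 * (d + 1)) with he
    have he0 : 0 < e := by positivity
    obtain ⟨η, hfin, hg, hη0⟩ := fm_cutoff m ω hm hnn hsymm hloc hA x0 e he0
    obtain ⟨A, hA0, hres⟩ := fm_resolvent m ω hm hnn hsymm hloc η hfin
    choose u hu1 hu2 hu3 hu4 using fun j : ℕ => hres (1 / ((j : ℝ) + 1)) (by positivity)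
    have hlow : ∀ j, 1 / 4 ≤ u j x0 := by
      intro j
      have hα : (0 : ℝ) < 1 / ((j : ℝ) + 1) := by positivity
      set α : ℝ := 1 / ((j : ℝ) + 1) with hαd
      have h1 := fm_grad m ω hm hnn hsymm hloc n K hn hK hCD hA η (u j) e α he0 hα hg
        (hu1 j) (hu2 j) x0
      rw [fm_gam m ω hloc] at h1
      have h2 := hu1 j x0
      rw [fm_lap m ω hloc] at h2
      have h3 := Finset.sum_sq_le_sum_mul_sum_of_sq_le_mul (hloc x0).toFinset
        (r := fun y => ω x0 y * (u j y - u j x0)) (f := fun y => ω x0 y)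
        (g := fun y => ω x0 y * ((u j y - u j x0) * (u j y - u j x0)))
        (fun y _ => hnn x0 y) (fun y _ => mul_nonneg (hnn x0 y) (mul_self_nonneg _))
        (fun y _ => le_of_eq (by ring))
      rw [← fm_deg ω hloc x0, ← hd] at h3
      set P := ∑ y ∈ (hloc x0).toFinset, ω x0 y * (u j y - u j x0)
      set Q := ∑ y ∈ (hloc x0).toFinset, ω x0 y * ((u j y - u j x0) * (u j y - u j x0))
      have hP : P = m x0 * (α * (u j x0 - η x0)) := by
        rw [← h2]; field_simp
      have hQ : Q ≤ 2 * m x0 * (α ^ 2 * e / K ^ 2) := by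
        have : Q = 2 * m x0 * (1 / (2 * m x0) * Q) := by field_simp
        rw [this]
        exact mul_le_mul_of_nonneg_left h1 (by positivity)
      have h4 : (m x0 * (α * (u j x0 - η x0))) ^ 2 ≤ d * (2 * m x0 * (α ^ 2 * e / K ^ 2)) := by
        rw [← hP]
        exact h3.trans (mul_le_mul_of_nonneg_left hQ hd0)
      have h5 : d * (2 * m x0 * (α ^ 2 * e / K ^ 2))
          = (m x0 * α) ^ 2 * ((d / (d + 1)) / 16) := by
        rw [he]; field_simp; ring
      have h6 : (m x0 * (α * (u j x0 - η x0))) ^ 2 = (m x0 * α) ^ 2 * (u j x0 - η x0) ^ 2 := by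
        ring
      rw [h5, h6] at h4
      have h7 := le_of_mul_le_mul_left h4 (by positivity)
      have h8 : d / (d + 1) ≤ 1 := by
        rw [div_le_one (by positivity)]; linarith
      have h9 : (u j x0 - η x0) ^ 2 ≤ (1 / 4) ^ 2 := by linarith
      have h10 := abs_le_of_sq_le_sq' h9 (by norm_num)
      linarith [h10.1]
    have hα0 : Tendsto (fun j : ℕ => 1 / ((j : ℝ) + 1)) atTop (𝓝 0) :=
      tendsto_one_div_add_atTop_nhds_zero_nat
    have hdiff : ∀ x, Tendsto (fun j => u j x - u j x0) atTop (𝓝 0) := by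
      intro x
      induction hconn x0 x with
      | refl => simp
      | @tail a b _ hab ih =>
        have h1 : Tendsto (fun j => (u j b - u j a) ^ 2) atTop (𝓝 0) := by
          have h2 : Tendsto (fun j : ℕ => 2 * (1 / ((j : ℝ) + 1)) * A / ω a b) atTop (𝓝 0) := by
            have := ((hα0.const_mul 2).mul_const A).div_const (ω a b)
            simpa using this
          refine squeeze_zero (fun j => sq_nonneg _) (fun j => ?_) h2
          rw [le_div_iff₀ hab]
          linarith [hu3 j a b]
        have h2 : Tendsto (fun j => u j b - u j a) atTop (𝓝 0) := by
          have h3 := h1.sqrt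
          simp only [Real.sqrt_sq_eq_abs, Real.sqrt_zero] at h3
          exact (tendsto_zero_iff_abs_tendsto_zero _).2 h3
        have h3 := h2.add ih
        simpa using h3
    refine summable_of_sum_le (c := 64 * A) (fun x => (hm x).le) ?_
    intro S
    have hev : ∀ᶠ j in atTop, ∀ x ∈ S, -(1 / 8) ≤ u j x - u j x0 := by
      rw [Filter.eventually_all_finset]
      intro x _
      exact (hdiff x).eventually_const_le (by norm_num)
    obtain ⟨j, hj⟩ := hev.exists
    have h1 := hu4 j S
    have h2 : ∑ x ∈ S, m x * (1 / 64) ≤ ∑ x ∈ S, m x * u j x ^ 2 := by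
      refine Finset.sum_le_sum fun x hx => mul_le_mul_of_nonneg_left ?_ (hm x).le
      have h3 := hj x hx
      have h4 := hlow j
      nlinarith
    rw [← Finset.sum_mul] at h2
    linarith
  refine ⟨hS, ?_⟩
  rintro ⟨δ, hδ, hδm⟩
  have h1 : ∀ᶠ z in cofinite, m z < δ := hS.tendsto_cofinite_zero.eventually_lt_const hδ
  rw [eventually_cofinite] at h1
  rw [← Set.finite_univ_iff]
  refine h1.subset ?_
  intro z _
  exact not_lt.2 (hδm z)
end

section
/- (Poincaré inequality) On a finite connected weighted graph satisfying CD(∞,K) with K > 0, for every function f, ‖f − f_V‖_{ℓ¹_m} ≤ (2π/√K) ‖√(Γ(f))‖_{ℓ¹_m}, where f_V = (1/|V|) Σ_x m(x) f(x). -/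
open Real Filter Topology
open scoped BigOperators

namespace PoincareAux

variable {V : Type*} [Fintype V]

/-- The Laplacian as a continuous linear map. -/
noncomputable def lapL (m : V → ℝ) (ω : V → V → ℝ) : (V → ℝ) →L[ℝ] (V → ℝ) :=
  LinearMap.toContinuousLinearMap
    { toFun := lapOp m ω
      map_add' := by
        intro f g
        ext x
        simp only [lapOp, tsum_fintype, Pi.add_apply]
        rw [← mul_add, ← Finset.sum_add_distrib]
        congr 1
        exact Finset.sum_congr rfl fun y _ => by ring
      map_smul' := by
        intro c f
        ext x
        simp only [lapOp, tsum_fintype, Pi.smul_apply, smul_eq_mul, RingHom.id_apply]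
        rw [mul_left_comm, Finset.mul_sum (a := c)]
        congr 1
        exact Finset.sum_congr rfl fun y _ => by ring }

theorem lapL_apply (m : V → ℝ) (ω : V → V → ℝ) (f : V → ℝ) : lapL m ω f = lapOp m ω f := rfl

/-- The heat semigroup. -/
noncomputable def heat (m : V → ℝ) (ω : V → V → ℝ) (t : ℝ) : (V → ℝ) →L[ℝ] (V → ℝ) :=
  NormedSpace.exp (t • lapL m ω)

variable (m : V → ℝ) (ω : V → V → ℝ)

theorem heat_zero : heat m ω 0 = 1 := by
  simp [heat, NormedSpace.exp_zero]

theorem heat_deriv (t : ℝ) : HasDerivAt (heat m ω) (heat m ω t * lapL m ω) t :=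
  hasDerivAt_exp_smul_const (𝕂 := ℝ) (lapL m ω) t

theorem heat_deriv' (t : ℝ) : HasDerivAt (heat m ω) (lapL m ω * heat m ω t) t :=
  hasDerivAt_exp_smul_const' (𝕂 := ℝ) (lapL m ω) t

theorem heat_apply_deriv (g : V → ℝ) (t : ℝ) :
    HasDerivAt (fun t => heat m ω t g) (lapOp m ω (heat m ω t g)) t := by
  have := (heat_deriv' m ω t).clm_apply (hasDerivAt_const t g)
  simpa [lapL_apply] using this

theorem heat_one (t : ℝ) : heat m ω t (fun _ => 1) = fun _ => 1 := by
  have h : ∀ s, HasDerivAt (fun t => heat m ω t (fun _ => 1)) 0 s := by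
    intro s
    have := (heat_deriv m ω s).clm_apply (hasDerivAt_const s (fun _ : V => (1 : ℝ)))
    have h0 : lapL m ω (fun _ => 1) = 0 := by
      ext x
      simp [lapL_apply, lapOp]
    simpa [h0] using this
  have := is_const_of_deriv_eq_zero (fun s => (h s).differentiableAt) (fun s => (h s).deriv) t 0
  simpa [heat_zero] using this

theorem exp_nonneg_of (A : (V → ℝ) →L[ℝ] (V → ℝ)) (hA : ∀ f : V → ℝ, 0 ≤ f → 0 ≤ A f)
    (f : V → ℝ) (hf : 0 ≤ f) : 0 ≤ NormedSpace.exp A f := by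
  have hp : ∀ n : ℕ, 0 ≤ (A ^ n) f := by
    intro n
    induction n with
    | zero => simpa using hf
    | succ k ih =>
      rw [pow_succ']
      exact hA _ ih
  have hs := NormedSpace.exp_series_hasSum_exp' (𝕂 := ℝ) A
  intro x
  have h2 := (hs.mapL (ContinuousLinearMap.apply ℝ (V → ℝ) f)).mapL
    (ContinuousLinearMap.proj (R := ℝ) (φ := fun _ : V => ℝ) x)
  refine h2.nonneg fun n => ?_
  simp only [ContinuousLinearMap.apply_apply, ContinuousLinearMap.proj_apply,
    smul_apply, Pi.smul_apply, smul_eq_mul]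
  exact mul_nonneg (by positivity) (hp n x)

theorem heat_nonneg (hm : ∀ x, 0 < m x) (hnn : ∀ x y, 0 ≤ ω x y) {t : ℝ} (ht : 0 ≤ t)
    (f : V → ℝ) (hf : 0 ≤ f) : 0 ≤ heat m ω t f := by
  classical
  set c : ℝ := ∑ x, (1 / m x) * ∑ y, ω x y with hc
  have hterm : ∀ x, 0 ≤ (1 / m x) * ∑ y, ω x y := fun x =>
    mul_nonneg (by have := hm x; positivity) (Finset.sum_nonneg fun y _ => hnn x y)
  have hcx : ∀ x, (1 / m x) * ∑ y, ω x y ≤ c := fun x =>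
    Finset.single_le_sum (f := fun x => (1 / m x) * ∑ y, ω x y)
      (fun x _ => hterm x) (Finset.mem_univ x)
  set A : (V → ℝ) →L[ℝ] (V → ℝ) := t • (lapL m ω + c • 1) with hA
  have hApos : ∀ f : V → ℝ, 0 ≤ f → 0 ≤ A f := by
    intro f hf x
    have hfx : ∀ x, 0 ≤ f x := hf
    have e : A f x = t * ((1 / m x) * ∑ y, ω x y * f y
        + (c - (1 / m x) * ∑ y, ω x y) * f x) := by
      simp only [hA, smul_apply, add_apply, lapL_apply,
        Pi.smul_apply, Pi.add_apply, smul_eq_mul, one_apply_eq_self, lapOp,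
        tsum_fintype, mul_sub, Finset.sum_sub_distrib, ← Finset.sum_mul]
      ring
    rw [e]
    have := hm x
    exact mul_nonneg ht (add_nonneg (mul_nonneg (by positivity)
      (Finset.sum_nonneg fun y _ => mul_nonneg (hnn x y) (hfx y)))
      (mul_nonneg (sub_nonneg.2 (hcx x)) (hfx x)))
  have e2 : t • lapL m ω = A + algebraMap ℝ ((V → ℝ) →L[ℝ] (V → ℝ)) (-(t * c)) := by
    rw [hA, Algebra.algebraMap_eq_smul_one, smul_add, smul_smul, neg_smul]
    abel
  have e3 : heat m ω t = NormedSpace.exp A * (Real.exp (-(t * c)) • 1) := by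
    rw [heat, e2]
    let _ : NormedAlgebra ℚ ((V → ℝ) →L[ℝ] (V → ℝ)) := NormedAlgebra.restrictScalars ℚ ℝ _
    rw [NormedSpace.exp_add_of_commute (Algebra.commutes _ _).symm]
    rw [← NormedSpace.algebraMap_exp_comm (𝕂 := ℝ), ← Real.exp_eq_exp_ℝ,
      Algebra.algebraMap_eq_smul_one]
  have e4 : heat m ω t f = Real.exp (-(t * c)) • NormedSpace.exp A f := by
    rw [e3]; simp
  rw [e4]
  exact smul_nonneg (Real.exp_pos _).le (exp_nonneg_of A hApos f hf)

theorem gam_eq (f g : V → ℝ) :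
    gamOp m ω f g = (1 / 2 : ℝ) • (lapL m ω (f * g) - f * lapL m ω g - lapL m ω f * g) := by
  ext x
  simp only [lapL_apply, gamOp, lapOp, tsum_fintype, Pi.smul_apply, Pi.sub_apply, Pi.mul_apply,
    smul_eq_mul]
  have : ∑ y, ω x y * (f y - f x) * (g y - g x) =
      ∑ y, ω x y * (f y * g y - f x * g x) - f x * ∑ y, ω x y * (g y - g x)
        - (∑ y, ω x y * (f y - f x)) * g x := by
    rw [Finset.mul_sum, Finset.sum_mul, ← Finset.sum_sub_distrib, ← Finset.sum_sub_distrib]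
    exact Finset.sum_congr rfl fun y _ => by ring
  rw [this, one_div, mul_inv]
  ring

theorem gam_comm (f g : V → ℝ) : gamOp m ω f g = gamOp m ω g f := by
  ext x
  simp only [gamOp, tsum_fintype]
  congr 1
  exact Finset.sum_congr rfl fun y _ => by ring

theorem gam_nonneg (hm : ∀ x, 0 < m x) (hnn : ∀ x y, 0 ≤ ω x y) (f : V → ℝ) (x : V) :
    0 ≤ gamOp m ω f f x := by
  simp only [gamOp, tsum_fintype]
  have := hm x
  refine mul_nonneg (by positivity) (Finset.sum_nonneg fun y _ => ?_)
  rw [mul_assoc]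
  exact mul_nonneg (hnn x y) (mul_self_nonneg _)

theorem gam_cs (hm : ∀ x, 0 < m x) (hnn : ∀ x y, 0 ≤ ω x y) (f g : V → ℝ) (x : V) :
    |gamOp m ω f g x| ≤ √(gamOp m ω f f x) * √(gamOp m ω g g x) := by
  rw [← Real.sqrt_mul (gam_nonneg m ω hm hnn f x)]
  apply Real.abs_le_sqrt
  simp only [gamOp, tsum_fintype]
  have h := Finset.sum_mul_sq_le_sq_mul_sq Finset.univ
    (fun y => √(ω x y) * (f y - f x)) (fun y => √(ω x y) * (g y - g x))
  have hs : ∀ y, √(ω x y) * √(ω x y) = ω x y := fun y => Real.mul_self_sqrt (hnn x y)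
  have e : ∀ a b : V → ℝ, ∀ y, √(ω x y) * (a y - a x) * (√(ω x y) * (b y - b x))
      = ω x y * (a y - a x) * (b y - b x) := by
    intro a b y
    linear_combination (a y - a x) * (b y - b x) * hs y
  simp only [pow_two (√_ * _), e] at h
  calc _ = (1 / (2 * m x)) ^ 2 * (∑ y, ω x y * (f y - f x) * (g y - g x)) ^ 2 := by ring
    _ ≤ (1 / (2 * m x)) ^ 2 * ((∑ y, ω x y * (f y - f x) * (f y - f x)) *
        ∑ y, ω x y * (g y - g x) * (g y - g x)) := by gcongr
    _ = _ := by ring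

theorem lap_parts (hm : ∀ x, 0 < m x) (hsymm : ∀ x y, ω x y = ω y x) (f g : V → ℝ) :
    ∑ x, m x * (f x * lapOp m ω g x) = - ∑ x, m x * gamOp m ω f g x := by
  have h1 : ∑ x, m x * (f x * lapOp m ω g x) = ∑ x, ∑ y, ω x y * f x * (g y - g x) := by
    refine Finset.sum_congr rfl fun x _ => ?_
    have := (hm x).ne'
    simp only [lapOp, tsum_fintype]
    field_simp
    rw [Finset.mul_sum]
    exact Finset.sum_congr rfl fun y _ => by ring
  have h2 : ∑ x, m x * gamOp m ω f g x
      = (1 / 2) * ∑ x, ∑ y, ω x y * (f y - f x) * (g y - g x) := by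
    rw [Finset.mul_sum]
    refine Finset.sum_congr rfl fun x _ => ?_
    have := (hm x).ne'
    simp only [gamOp, tsum_fintype]
    field_simp
  have h3 : ∑ x, ∑ y, ω x y * f x * (g y - g x) = ∑ x, ∑ y, ω x y * f y * (g x - g y) := by
    rw [Finset.sum_comm]
    refine Finset.sum_congr rfl fun x _ => Finset.sum_congr rfl fun y _ => ?_
    rw [hsymm]
  have h4 : ∑ x, ∑ y, ω x y * (f y - f x) * (g y - g x) =
      - ∑ x, ∑ y, ω x y * f y * (g x - g y) - ∑ x, ∑ y, ω x y * f x * (g y - g x) := by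
    rw [← Finset.sum_neg_distrib, ← Finset.sum_sub_distrib]
    refine Finset.sum_congr rfl fun x _ => ?_
    rw [← Finset.sum_neg_distrib, ← Finset.sum_sub_distrib]
    exact Finset.sum_congr rfl fun y _ => by ring
  rw [h1, h2, h4, ← h3]
  ring

/-- Backward heat flow derivative. -/
theorem back_deriv (g : V → ℝ) (s r : ℝ) :
    HasDerivAt (fun r => heat m ω (s - r) g) (-lapL m ω (heat m ω (s - r) g)) r := by
  have h := (heat_apply_deriv m ω g (s - r)).scomp r ((hasDerivAt_id r).const_sub s)
  simpa [lapL_apply, Function.comp_def] using h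

theorem theta_deriv (g : V → ℝ) (s r : ℝ) :
    HasDerivAt (fun r => heat m ω r (heat m ω (s - r) g * heat m ω (s - r) g))
      (heat m ω r ((2 : ℝ) • gamOp m ω (heat m ω (s - r) g) (heat m ω (s - r) g))) r := by
  have hv := back_deriv m ω g s r
  have h := (heat_deriv m ω r).clm_apply (hv.mul hv)
  refine h.congr_deriv (Eq.symm ?_)
  set v := heat m ω (s - r) g
  have hmul : ∀ u, (heat m ω r * lapL m ω) u = heat m ω r (lapL m ω u) := fun _ => rfl
  rw [hmul]
  rw [← map_add]
  congr 1
  rw [gam_eq, smul_smul]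
  norm_num
  ring

theorem psi_deriv (g : V → ℝ) (s r : ℝ) :
    HasDerivAt (fun r => heat m ω r (gamOp m ω (heat m ω (s - r) g) (heat m ω (s - r) g)))
      (heat m ω r ((2 : ℝ) • gam2Op m ω (heat m ω (s - r) g))) r := by
  have hv := back_deriv m ω g s r
  have hLv := (lapL m ω).hasFDerivAt.comp_hasDerivAt r hv
  have hL2 := (lapL m ω).hasFDerivAt.comp_hasDerivAt r (hv.mul hv)
  have hG := ((hL2.sub (hv.mul hLv)).sub (hLv.mul hv)).const_smul (1 / 2 : ℝ)
  have h := (heat_deriv m ω r).clm_apply hG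
  simp only [gam_eq]
  refine h.congr_deriv (Eq.symm ?_)
  set v := heat m ω (s - r) g
  have e2 : gam2Op m ω v = (1 / 2 : ℝ) • lapL m ω (gamOp m ω v v) - gamOp m ω v (lapL m ω v) := by
    ext x; rfl
  have hmul : ∀ u, (heat m ω r * lapL m ω) u = heat m ω r (lapL m ω u) := fun _ => rfl
  rw [hmul, ← map_add]
  congr 1
  rw [e2, gam_eq, gam_eq]
  have e3 : (-lapL m ω v * v + v * -lapL m ω v) = (-2 : ℝ) • (v * lapL m ω v) := by
    ext x
    simp
    ring
  rw [e3]
  simp only [Function.comp_def, Pi.sub_apply, Pi.mul_apply, Pi.smul_apply, map_neg, map_smul]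
  ext x
  simp
  ring

theorem heat_mono (hm : ∀ x, 0 < m x) (hnn : ∀ x y, 0 ≤ ω x y) {t : ℝ} (ht : 0 ≤ t)
    {f g : V → ℝ} (hfg : f ≤ g) : heat m ω t f ≤ heat m ω t g := by
  have := heat_nonneg m ω hm hnn ht (g - f) (sub_nonneg.2 hfg)
  rw [map_sub] at this
  exact sub_nonneg.1 this

theorem mono_of_hasDeriv {F F' : ℝ → ℝ} {s : ℝ} (hs : 0 ≤ s)
    (hc : ContinuousOn F (Set.Icc 0 s))
    (hF : ∀ r, 0 < r → HasDerivAt F (F' r) r) (hF' : ∀ r, 0 < r → 0 ≤ F' r) :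
    F 0 ≤ F s := by
  refine monotoneOn_of_deriv_nonneg (convex_Icc 0 s) hc ?_ ?_ (Set.left_mem_Icc.2 hs)
    (Set.right_mem_Icc.2 hs) hs
  · intro r hr
    rw [interior_Icc] at hr
    exact (hF r hr.1).differentiableAt.differentiableWithinAt
  · intro r hr
    rw [interior_Icc] at hr
    rw [(hF r hr.1).deriv]
    exact hF' r hr.1

theorem psi_lower (hm : ∀ x, 0 < m x) (hnn : ∀ x y, 0 ≤ ω x y) (K : ℝ)
    (hCD : ∀ (f : V → ℝ) (x : V), gam2Op m ω f x ≥ K * gamOp m ω f f x)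
    (g : V → ℝ) (s r : ℝ) (hr : 0 ≤ r) (x : V) :
    Real.exp (2 * K * r) * gamOp m ω (heat m ω s g) (heat m ω s g) x ≤
      heat m ω r (gamOp m ω (heat m ω (s - r) g) (heat m ω (s - r) g)) x := by
  set ψ : ℝ → ℝ := fun r =>
    heat m ω r (gamOp m ω (heat m ω (s - r) g) (heat m ω (s - r) g)) x with hψ
  have hd : ∀ r, HasDerivAt ψ
      (heat m ω r ((2 : ℝ) • gam2Op m ω (heat m ω (s - r) g)) x) r := fun r =>
    (hasDerivAt_pi.1 (psi_deriv m ω g s r)) x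
  have hle : ∀ r, 0 ≤ r → 2 * K * ψ r ≤
      heat m ω r ((2 : ℝ) • gam2Op m ω (heat m ω (s - r) g)) x := by
    intro r hr
    have h1 : (2 * K) • gamOp m ω (heat m ω (s - r) g) (heat m ω (s - r) g) ≤
        (2 : ℝ) • gam2Op m ω (heat m ω (s - r) g) := by
      intro y
      have := hCD (heat m ω (s - r) g) y
      simp only [Pi.smul_apply, smul_eq_mul]
      linarith
    have h2 := heat_mono m ω hm hnn hr h1 x
    rw [map_smul] at h2
    simpa using h2
  have hE : ∀ r, HasDerivAt (fun r : ℝ => Real.exp (-(2 * K) * r))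
      (Real.exp (-(2 * K) * r) * (-(2 * K))) r := fun r => by
    simpa using ((hasDerivAt_id r).const_mul (-(2 * K))).exp
  have hprod := fun r => (hE r).mul (hd r)
  have key := mono_of_hasDeriv hr (fun r _ => (hprod r).continuousAt.continuousWithinAt)
    (fun r _ => hprod r) (fun r hr => by
      have := hle r hr.le
      have hp := Real.exp_pos (-(2 * K) * r)
      nlinarith)
  simp only [Pi.mul_apply, mul_zero, Real.exp_zero, one_mul] at key
  have h0 : ψ 0 = gamOp m ω (heat m ω s g) (heat m ω s g) x := by
    simp [hψ, heat_zero]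
  rw [← h0]
  calc Real.exp (2 * K * r) * ψ 0 ≤ Real.exp (2 * K * r) * (Real.exp (-(2 * K) * r) * ψ r) := by
        gcongr
    _ = ψ r := by
      rw [← mul_assoc, ← Real.exp_add]
      simp

theorem reverse_poincare (hm : ∀ x, 0 < m x) (hnn : ∀ x y, 0 ≤ ω x y) (K : ℝ) (hK : 0 < K)
    (hCD : ∀ (f : V → ℝ) (x : V), gam2Op m ω f x ≥ K * gamOp m ω f f x)
    (g : V → ℝ) (hg : ∀ x, |g x| ≤ 1) (s : ℝ) (hs : 0 ≤ s) (x : V) :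
    (Real.exp (2 * K * s) - 1) * gamOp m ω (heat m ω s g) (heat m ω s g) x ≤ K := by
  set G := gamOp m ω (heat m ω s g) (heat m ω s g) x with hG
  set θ : ℝ → ℝ := fun r => heat m ω r (heat m ω (s - r) g * heat m ω (s - r) g) x with hθ
  have hd : ∀ r, HasDerivAt θ (heat m ω r
      ((2 : ℝ) • gamOp m ω (heat m ω (s - r) g) (heat m ω (s - r) g)) x) r := fun r =>
    (hasDerivAt_pi.1 (theta_deriv m ω g s r)) x
  have hE : ∀ r, HasDerivAt (fun r : ℝ => Real.exp (2 * K * r) * (G / K))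
      (Real.exp (2 * K * r) * (2 * K) * (G / K)) r := fun r => by
    simpa using (((hasDerivAt_id r).const_mul (2 * K)).exp).mul_const (G / K)
  have hsub := fun r => (hd r).sub (hE r)
  have key := mono_of_hasDeriv hs (fun r _ => (hsub r).continuousAt.continuousWithinAt)
    (fun r _ => hsub r) (fun r hr => by
      have h1 := psi_lower m ω hm hnn K hCD g s r hr.le x
      rw [← hG] at h1
      have h2 : Real.exp (2 * K * r) * (2 * K) * (G / K) = 2 * (Real.exp (2 * K * r) * G) := by
        field_simp
      rw [h2, map_smul]
      simp only [Pi.smul_apply, smul_eq_mul]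
      linarith)
  simp only [Pi.sub_apply, mul_zero, Real.exp_zero, one_mul] at key
  have h0 : 0 ≤ θ 0 := by
    simp only [hθ, heat_zero]
    exact mul_self_nonneg _
  have h1 : θ s ≤ 1 := by
    simp only [hθ, sub_self, heat_zero]
    have hle : g * g ≤ fun _ => 1 := by
      intro y
      have := abs_le.1 (hg y)
      simp only [Pi.mul_apply]
      nlinarith
    have := heat_mono m ω hm hnn hs hle x
    rw [heat_one] at this
    exact this
  have h3 : (Real.exp (2 * K * s) - 1) * (G / K) ≤ 1 := by linarith
  rw [← mul_div_assoc, div_le_one hK] at h3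
  exact h3

theorem H_deriv (K : ℝ) (hK : 0 < K) (t : ℝ) (ht : 0 < t) :
    HasDerivAt (fun t => (1 / √K) * Real.arctan (√(Real.exp (2 * K * t) - 1)))
      (√K / √(Real.exp (2 * K * t) - 1)) t := by
  have hpos : 0 < Real.exp (2 * K * t) - 1 := by
    have : 1 < Real.exp (2 * K * t) := Real.one_lt_exp_iff.2 (by positivity)
    linarith
  have hE : HasDerivAt (fun r : ℝ => Real.exp (2 * K * r) - 1)
      (Real.exp (2 * K * t) * (2 * K)) t := by
    simpa using (((hasDerivAt_id t).const_mul (2 * K)).exp).sub_const 1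
  have h := ((hE.sqrt hpos.ne').arctan).const_mul (1 / √K)
  refine h.congr_deriv (Eq.symm ?_)
  have hq := Real.sq_sqrt hpos.le
  have hk := Real.sq_sqrt hK.le
  have hqp := Real.sqrt_pos.2 hpos
  have hkp := Real.sqrt_pos.2 hK
  rw [hq]
  have := Real.exp_pos (2 * K * t)
  rw [add_sub_cancel]
  field_simp
  exact hk

theorem phi_bound (hm : ∀ x, 0 < m x) (hnn : ∀ x y, 0 ≤ ω x y)
    (hsymm : ∀ x y, ω x y = ω y x) (K : ℝ) (hK : 0 < K)
    (hCD : ∀ (f : V → ℝ) (x : V), gam2Op m ω f x ≥ K * gamOp m ω f f x)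
    (f g : V → ℝ) (hg : ∀ x, |g x| ≤ 1) (t : ℝ) (ht : 0 ≤ t) :
    ∑ x, m x * (f x * g x) ≤ ∑ x, m x * (f x * heat m ω t g x) +
      (π / 2 / √K) * ∑ x, m x * √(gamOp m ω f f x) := by
  set S := ∑ x, m x * √(gamOp m ω f f x) with hS
  have hS0 : 0 ≤ S := Finset.sum_nonneg fun x _ => mul_nonneg (hm x).le (Real.sqrt_nonneg _)
  set φ : ℝ → ℝ := fun t => ∑ x, m x * (f x * heat m ω t g x) with hφ
  have hd : ∀ t, HasDerivAt φ (-∑ x, m x * gamOp m ω f (heat m ω t g) x) t := by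
    intro t
    rw [← lap_parts m ω hm hsymm]
    refine HasDerivAt.fun_sum fun x _ => ?_
    exact ((hasDerivAt_pi.1 (heat_apply_deriv m ω g t) x).const_mul (f x)).const_mul (m x)
  set H : ℝ → ℝ := fun t => (1 / √K) * Real.arctan (√(Real.exp (2 * K * t) - 1)) with hH
  have hHc : Continuous H := by
    have := Real.continuous_arctan
    fun_prop
  have hφc : Continuous φ := continuous_iff_continuousAt.2 fun t => (hd t).continuousAt
  have hkp := Real.sqrt_pos.2 hK
  have key := mono_of_hasDeriv (F := fun t => φ t + S * H t) ht
    (hφc.add (continuous_const.mul hHc)).continuousOn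
    (fun r hr => (hd r).add ((H_deriv K hK r hr).const_mul S)) (fun r hr => by
      have hpos : 0 < Real.exp (2 * K * r) - 1 := by
        have : 1 < Real.exp (2 * K * r) := Real.one_lt_exp_iff.2 (by positivity)
        linarith
      have hb : ∀ x, m x * gamOp m ω f (heat m ω r g) x ≤
          m x * √(gamOp m ω f f x) * (√K / √(Real.exp (2 * K * r) - 1)) := by
        intro x
        rw [mul_assoc]
        refine mul_le_mul_of_nonneg_left ?_ (hm x).le
        refine (le_abs_self _).trans ((gam_cs m ω hm hnn _ _ x).trans ?_)
        refine mul_le_mul_of_nonneg_left ?_ (Real.sqrt_nonneg _)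
        rw [← Real.sqrt_div hK.le]
        apply Real.sqrt_le_sqrt
        rw [le_div_iff₀ hpos, mul_comm]
        exact reverse_poincare m ω hm hnn K hK hCD g hg r hr.le x
      have := Finset.sum_le_sum fun x (_ : x ∈ Finset.univ) => hb x
      rw [← Finset.sum_mul, ← hS] at this
      linarith)
  have h0 : H 0 = 0 := by simp [hH]
  have hφ0 : φ 0 = ∑ x, m x * (f x * g x) := by simp [hφ, heat_zero]
  have hHt : H t ≤ π / 2 / √K := by
    have := (Real.arctan_lt_pi_div_two (√(Real.exp (2 * K * t) - 1))).le
    calc H t ≤ (1 / √K) * (π / 2) := by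
          simp only [hH]; gcongr
      _ = _ := by ring
  simp only [h0, hφ0, mul_zero, add_zero] at key
  have := mul_le_mul_of_nonneg_left hHt hS0
  linarith

theorem heat_diff_tendsto (hm : ∀ x, 0 < m x) (hnn : ∀ x y, 0 ≤ ω x y) (K : ℝ) (hK : 0 < K)
    (hCD : ∀ (f : V → ℝ) (x : V), gam2Op m ω f x ≥ K * gamOp m ω f f x)
    (g : V → ℝ) (hg : ∀ x, |g x| ≤ 1) (a b : V)
    (hab : Relation.ReflTransGen (fun a b => 0 < ω a b) a b) :
    Tendsto (fun t => heat m ω t g b - heat m ω t g a) atTop (𝓝 0) := by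
  induction hab with
  | refl => simp
  | @tail b c _ hbc ih =>
    have hstep : Tendsto (fun t => heat m ω t g c - heat m ω t g b) atTop (𝓝 0) := by
      have hexp : Tendsto (fun t : ℝ => Real.exp (2 * K * t) - 1) atTop atTop := by
        refine tendsto_atTop_add_const_right _ _ (Real.tendsto_exp_atTop.comp ?_)
        exact tendsto_id.const_mul_atTop (by positivity)
      have hlim : Tendsto (fun t : ℝ => √(2 * m b / ω b c * (K / (Real.exp (2 * K * t) - 1))))
          atTop (𝓝 0) := by
        have h := ((hexp.const_div_atTop K).const_mul (2 * m b / ω b c)).sqrt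
        simpa using h
      refine squeeze_zero_norm' ?_ hlim
      filter_upwards [eventually_gt_atTop 0] with t ht
      rw [Real.norm_eq_abs]
      apply Real.abs_le_sqrt
      have hpos : 0 < Real.exp (2 * K * t) - 1 := by
        have : 1 < Real.exp (2 * K * t) := Real.one_lt_exp_iff.2 (by positivity)
        linarith
      have hr := reverse_poincare m ω hm hnn K hK hCD g hg t ht.le b
      rw [mul_comm, ← le_div_iff₀ hpos] at hr
      set v := heat m ω t g
      have hs : ω b c * (v c - v b) * (v c - v b) ≤ 2 * m b * gamOp m ω v v b := by
        have h1 := Finset.single_le_sum (f := fun y => ω b y * (v y - v b) * (v y - v b))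
          (fun y _ => by
            show 0 ≤ ω b y * (v y - v b) * (v y - v b)
            rw [mul_assoc]
            exact mul_nonneg (hnn b y) (mul_self_nonneg _)) (Finset.mem_univ c)
        have h2 : 2 * m b * gamOp m ω v v b = ∑ y, ω b y * (v y - v b) * (v y - v b) := by
          have := (hm b).ne'
          simp only [gamOp, tsum_fintype]
          field_simp
        rw [h2]
        exact h1
      have hmb := hm b
      calc (v c - v b) ^ 2 = (ω b c * (v c - v b) * (v c - v b)) / ω b c := by
            field_simp
        _ ≤ (2 * m b * gamOp m ω v v b) / ω b c := by gcongr
        _ ≤ (2 * m b * (K / (Real.exp (2 * K * t) - 1))) / ω b c := by gcongr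
        _ = _ := by ring
    have := hstep.add ih
    simpa using this

end PoincareAux

/-- Poincaré inequality on a finite graph with positive curvature. -/
theorem poincare_inequality {V : Type*} [Fintype V] [Nonempty V]
    (m : V → ℝ) (ω : V → V → ℝ)
    (hm : ∀ x, 0 < m x) (hnn : ∀ x y, 0 ≤ ω x y) (hsymm : ∀ x y, ω x y = ω y x)
    (hconn : ∀ x y : V, Relation.ReflTransGen (fun a b => 0 < ω a b) x y)
    (K : ℝ) (hK : 0 < K)
    (hCD : ∀ (f : V → ℝ) (x : V), gam2Op m ω f x ≥ K * gamOp m ω f f x) :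
    ∀ f : V → ℝ,
      ∑ x, m x * |f x - (∑ y, m y * f y) / (∑ y, m y)|
        ≤ (2 * Real.pi / Real.sqrt K) * ∑ x, m x * Real.sqrt (gamOp m ω f f x) := by
  intro f
  obtain ⟨x₀⟩ := ‹Nonempty V›
  set c := (∑ y, m y * f y) / (∑ y, m y) with hc
  set f₀ : V → ℝ := fun x => f x - c with hf₀
  have hM : 0 < ∑ y, m y := Finset.sum_pos (fun y _ => hm y) ⟨x₀, Finset.mem_univ _⟩
  have hmean : ∑ x, m x * f₀ x = 0 := by
    simp only [hf₀, mul_sub, Finset.sum_sub_distrib, ← Finset.sum_mul]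
    rw [hc]
    field_simp
    ring
  have hgam : gamOp m ω f₀ f₀ = gamOp m ω f f := by
    ext x
    simp [gamOp, hf₀]
  set g : V → ℝ := fun x => SignType.sign (f₀ x) with hgdef
  have hg : ∀ x, |g x| ≤ 1 := by
    intro x
    rcases lt_trichotomy (f₀ x) 0 with h | h | h <;> simp [hgdef, h]
  have hfg : ∀ x, f₀ x * g x = |f₀ x| := fun x => self_mul_sign _
  have hlim : Tendsto (fun t => ∑ x, m x * (f₀ x * PoincareAux.heat m ω t g x)) atTop (𝓝 0) := by
    have h1 : Tendsto (fun t => ∑ x, m x * (f₀ x *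
        (PoincareAux.heat m ω t g x - PoincareAux.heat m ω t g x₀))) atTop
        (𝓝 (∑ x, m x * (f₀ x * 0))) :=
      tendsto_finsetSum _ fun x _ => ((PoincareAux.heat_diff_tendsto m ω hm hnn K hK hCD g hg
        x₀ x (hconn x₀ x)).const_mul _).const_mul _
    simp only [mul_zero, Finset.sum_const_zero] at h1
    refine h1.congr fun t => ?_
    simp only [mul_sub, Finset.sum_sub_distrib, ← mul_assoc, ← Finset.sum_mul]
    rw [hmean]
    ring
  have hb : ∀ᶠ t in atTop, ∑ x, m x * |f₀ x| ≤
      ∑ x, m x * (f₀ x * PoincareAux.heat m ω t g x) +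
      (π / 2 / √K) * ∑ x, m x * √(gamOp m ω f f x) := by
    filter_upwards [eventually_ge_atTop 0] with t ht
    have := PoincareAux.phi_bound m ω hm hnn hsymm K hK hCD f₀ g hg t ht
    simpa only [hfg, hgam] using this
  have hfin := ge_of_tendsto (hlim.add_const _) hb
  rw [zero_add] at hfin
  refine hfin.trans (mul_le_mul_of_nonneg_right ?_
    (Finset.sum_nonneg fun x _ => mul_nonneg (hm x).le (Real.sqrt_nonneg _)))
  have := Real.pi_pos
  gcongr
  linarith
end

section
/- (Cheeger constant lower bound) Let G be a finite connected weighted graph satisfying CD(∞,K) with K > 0 and D_ω = sup_x sup_{y∼x} m(x)/ω_{xy} < ∞. Then the Cheeger constant h = min_{∅≠U⊊V} |∂U| / min{|U|, |V\U|} satisfies h ≥ √K / (2π√(2D_ω)). -/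
open Real Filter Topology
open scoped BigOperators

lemma lapF {V : Type*} [Fintype V] (m : V → ℝ) (ω : V → V → ℝ) (f : V → ℝ) (x : V) :
    lapOp m ω f x = (1 / m x) * ∑ y, ω x y * (f y - f x) := by
  simp [lapOp, tsum_fintype]

lemma gamF {V : Type*} [Fintype V] (m : V → ℝ) (ω : V → V → ℝ) (f g : V → ℝ) (x : V) :
    gamOp m ω f g x = (1 / (2 * m x)) * ∑ y, ω x y * (f y - f x) * (g y - g x) := by
  simp [gamOp, tsum_fintype]

lemma antisymm_sum {V : Type*} (ω : V → V → ℝ) (hsymm : ∀ x y, ω x y = ω y x)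
    (u : V → ℝ) (s : Finset V) : ∑ x ∈ s, ∑ y ∈ s, ω x y * (u y - u x) = 0 := by
  have h : ∑ x ∈ s, ∑ y ∈ s, ω x y * (u y - u x)
      = - ∑ x ∈ s, ∑ y ∈ s, ω x y * (u y - u x) := by
    conv_lhs => rw [Finset.sum_comm]
    rw [← Finset.sum_neg_distrib]
    refine Finset.sum_congr rfl fun x _ => ?_
    rw [← Finset.sum_neg_distrib]
    refine Finset.sum_congr rfl fun y _ => ?_
    rw [hsymm y x]; ring
  linarith

lemma heat_exists {V : Type*} [Fintype V] (m : V → ℝ) (ω : V → V → ℝ) (g : V → ℝ) :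
    ∃ u : ℝ → V → ℝ, u 0 = g ∧
      ∀ t x, HasDerivAt (fun s => u s x) (lapOp m ω (u t) x) t := by
  let L0 : (V → ℝ) →ₗ[ℝ] (V → ℝ) :=
    { toFun := fun f => lapOp m ω f
      map_add' := by
        intro f h; ext x
        simp only [lapF, Pi.add_apply]
        rw [← mul_add, ← Finset.sum_add_distrib]
        congr 1; refine Finset.sum_congr rfl fun y _ => ?_
        ring
      map_smul' := by
        intro c f; ext x
        simp only [lapF, Pi.smul_apply, smul_eq_mul, RingHom.id_apply]
        rw [mul_left_comm, Finset.mul_sum (a := c)]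
        congr 1; refine Finset.sum_congr rfl fun y _ => ?_
        ring }
  let L : (V → ℝ) →L[ℝ] (V → ℝ) := LinearMap.toContinuousLinearMap L0
  refine ⟨fun t => NormedSpace.exp (t • L) g, by simp, fun t x => ?_⟩
  have h := hasDerivAt_exp_smul_const' (𝕂 := ℝ) L t
  have h2 := h.clm_apply (hasDerivAt_const t g)
  have h3 := (hasDerivAt_pi.1 h2) x
  refine h3.congr_deriv ?_
  simp [L, L0]

lemma hasDerivAt_posSq (x : ℝ) : HasDerivAt (fun y : ℝ => (max y 0) ^ 2) (2 * max x 0) x := by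
  rw [hasDerivAt_iff_isLittleO]
  have h1 : (fun y : ℝ => (max y 0) ^ 2 - (max x 0) ^ 2 - (y - x) • (2 * max x 0))
      =O[𝓝 x] fun y => (y - x) ^ 2 := by
    refine Asymptotics.IsBigO.of_bound 1 (Eventually.of_forall fun y => ?_)
    rw [Real.norm_eq_abs, Real.norm_eq_abs, abs_of_nonneg (sq_nonneg (y - x)), one_mul, smul_eq_mul,
      abs_le]
    rcases max_cases y 0 with ⟨h, h'⟩ | ⟨h, h'⟩ <;> rcases max_cases x 0 with ⟨k, k'⟩ | ⟨k, k'⟩ <;>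
      rw [h, k] <;> constructor <;> nlinarith [sq_nonneg (y - x)]
  refine h1.trans_isLittleO ?_
  have : Tendsto (fun y : ℝ => y - x) (𝓝 x) (𝓝 0) := by
    have : Continuous fun y : ℝ => y - x := by fun_prop
    simpa using this.tendsto x
  have h2 := (Asymptotics.isLittleO_pow_id (𝕜 := ℝ) (n := 2) (by norm_num)).comp_tendsto this
  exact h2

lemma max_principle {V : Type*} [Fintype V] (m : V → ℝ) (ω : V → V → ℝ)
    (hm : ∀ x, 0 < m x) (hnn : ∀ x y, 0 ≤ ω x y) (hsymm : ∀ x y, ω x y = ω y x)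
    (w w' : ℝ → V → ℝ) (hd : ∀ t x, HasDerivAt (fun s => w s x) (w' t x) t)
    (hle : ∀ t, 0 ≤ t → ∀ x, w' t x ≤ lapOp m ω (w t) x) (h0 : ∀ x, w 0 x ≤ 0) :
    ∀ t, 0 ≤ t → ∀ x, w t x ≤ 0 := by
  set E : ℝ → ℝ := fun t => ∑ x, m x * (max (w t x) 0) ^ 2 with hE
  have hEd : ∀ t, HasDerivAt E (∑ x, m x * (2 * max (w t x) 0 * w' t x)) t := by
    intro t
    refine HasDerivAt.fun_sum fun x _ => ?_
    have h1 : HasDerivAt (fun s => (max (w s x) 0) ^ 2) (2 * max (w t x) 0 * w' t x) t :=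
      HasDerivAt.comp (h₂ := fun y : ℝ => (max y 0) ^ 2) t (hasDerivAt_posSq (w t x)) (hd t x)
    exact h1.const_mul (m x)
  have hanti : AntitoneOn E (Set.Ici 0) := by
    refine antitoneOn_of_deriv_nonpos (convex_Ici 0)
      (fun t _ => (hEd t).continuousAt.continuousWithinAt)
      (fun t _ => (hEd t).differentiableAt.differentiableWithinAt) fun t ht => ?_
    rw [interior_Ici] at ht
    rw [(hEd t).deriv]
    have h1 : ∑ x, m x * (2 * max (w t x) 0 * w' t x) ≤
        ∑ x, ∑ y, 2 * max (w t x) 0 * (ω x y * (w t y - w t x)) := by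
      refine Finset.sum_le_sum fun x _ => ?_
      have := hle t (le_of_lt ht) x
      rw [lapF] at this
      have hmx := hm x
      rw [← Finset.mul_sum]
      have h2 : m x * w' t x ≤ ∑ y, ω x y * (w t y - w t x) := by
        calc m x * w' t x ≤ m x * (1 / m x * ∑ y, ω x y * (w t y - w t x)) := by gcongr
          _ = _ := by field_simp
      calc m x * (2 * max (w t x) 0 * w' t x) = 2 * max (w t x) 0 * (m x * w' t x) := by ring
        _ ≤ _ := by gcongr
    have h2 : ∑ x, ∑ y, 2 * max (w t x) 0 * (ω x y * (w t y - w t x)) =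
        ∑ x, ∑ y, 2 * max (w t y) 0 * (ω x y * (w t x - w t y)) := by
      rw [Finset.sum_comm]
      refine Finset.sum_congr rfl fun x _ => Finset.sum_congr rfl fun y _ => ?_
      rw [hsymm x y]
    have h3 : ∑ x, ∑ y, 2 * max (w t x) 0 * (ω x y * (w t y - w t x)) +
        ∑ x, ∑ y, 2 * max (w t y) 0 * (ω x y * (w t x - w t y)) ≤ 0 := by
      rw [← Finset.sum_add_distrib]
      refine Finset.sum_nonpos fun x _ => ?_
      rw [← Finset.sum_add_distrib]
      refine Finset.sum_nonpos fun y _ => ?_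
      have : (max (w t x) 0 - max (w t y) 0) * (w t y - w t x) ≤ 0 := by
        rcases le_total (w t x) (w t y) with h | h
        · exact mul_nonpos_of_nonpos_of_nonneg (sub_nonpos.2 (max_le_max_right 0 h)) (by linarith)
        · exact mul_nonpos_of_nonneg_of_nonpos (sub_nonneg.2 (max_le_max_right 0 h)) (by linarith)
      nlinarith [mul_nonneg (hnn x y) (neg_nonneg.2 this)]
    linarith
  intro t ht x
  have hEt := hanti (Set.mem_Ici.2 le_rfl) (Set.mem_Ici.2 ht) ht
  have hE0 : E 0 = 0 := by
    refine Finset.sum_eq_zero fun x _ => ?_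
    rw [max_eq_right (h0 x)]; ring
  have h1 : m x * (max (w t x) 0) ^ 2 ≤ E t :=
    Finset.single_le_sum (f := fun x => m x * (max (w t x) 0) ^ 2)
      (fun y _ => mul_nonneg (hm y).le (sq_nonneg _)) (Finset.mem_univ x)
  have hmx := hm x
  by_contra hc
  push Not at hc
  rw [max_eq_left hc.le] at h1
  have : 0 < m x * w t x ^ 2 := by positivity
  linarith

/-- Reverse Poincaré inequality along the heat flow. -/
lemma grad_bound {V : Type*} [Fintype V] (m : V → ℝ) (ω : V → V → ℝ)
    (hm : ∀ x, 0 < m x) (hnn : ∀ x y, 0 ≤ ω x y) (hsymm : ∀ x y, ω x y = ω y x)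
    (K : ℝ) (hK : 0 < K)
    (hCD : ∀ (f : V → ℝ) (x : V), gam2Op m ω f x ≥ K * gamOp m ω f f x)
    (u : ℝ → V → ℝ) (h0 : ∀ x, u 0 x ^ 2 ≤ 1)
    (hu : ∀ t x, HasDerivAt (fun s => u s x) (lapOp m ω (u t) x) t) :
    ∀ t, 0 ≤ t → ∀ x, (exp (2 * K * t) - 1) / K * gamOp m ω (u t) (u t) x ≤ 1 := by
  have hG : ∀ t x, HasDerivAt (fun s => gamOp m ω (u s) (u s) x)
      (2 * gamOp m ω (u t) (lapOp m ω (u t)) x) t := by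
    intro t x
    simp only [gamF m ω (u _)]
    have h : HasDerivAt (fun s => ∑ y, ω x y * (u s y - u s x) * (u s y - u s x))
        (∑ y, 2 * (ω x y * (u t y - u t x) * (lapOp m ω (u t) y - lapOp m ω (u t) x))) t := by
      refine HasDerivAt.fun_sum fun y _ => ?_
      have h1 := (hu t y).sub (hu t x)
      have h2 := (h1.const_mul (ω x y)).mul h1
      refine h2.congr_deriv ?_
      simp only [Pi.sub_apply]
      ring
    refine (h.const_mul (1 / (2 * m x))).congr_deriv ?_
    rw [← Finset.mul_sum]; ring
  have hφ : ∀ t, HasDerivAt (fun s => (exp (2 * K * s) - 1) / K) (2 * exp (2 * K * t)) t := by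
    intro t
    have h1 : HasDerivAt (fun s : ℝ => 2 * K * s) (2 * K) t := by
      simpa using (hasDerivAt_id t).const_mul (2 * K)
    refine ((h1.exp.sub_const 1).div_const K).congr_deriv ?_
    field_simp
  have key := max_principle m ω hm hnn hsymm
    (fun t x => (exp (2 * K * t) - 1) / K * gamOp m ω (u t) (u t) x + u t x ^ 2 - 1)
    (fun t x => 2 * exp (2 * K * t) * gamOp m ω (u t) (u t) x
      + (exp (2 * K * t) - 1) / K * (2 * gamOp m ω (u t) (lapOp m ω (u t)) x)
      + 2 * u t x * lapOp m ω (u t) x)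
    (fun t x => by
      refine ((((hφ t).mul (hG t x)).add ((hu t x).pow 2)).sub_const 1).congr_deriv ?_
      simp)
    (fun t ht x => by
      have hlin : lapOp m ω (fun x => (exp (2 * K * t) - 1) / K * gamOp m ω (u t) (u t) x
          + u t x ^ 2 - 1) x
          = (exp (2 * K * t) - 1) / K * lapOp m ω (fun z => gamOp m ω (u t) (u t) z) x
            + (2 * u t x * lapOp m ω (u t) x + 2 * gamOp m ω (u t) (u t) x) := by
        generalize hγ : (fun z => gamOp m ω (u t) (u t) z) = γ
        have hγ' : ∀ z, gamOp m ω (u t) (u t) z = γ z := fun z => congrFun hγ z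
        have e : 2 * gamOp m ω (u t) (u t) x
            = 1 / m x * ∑ y, ω x y * (u t y - u t x) * (u t y - u t x) := by
          rw [gamF]; ring
        rw [e]
        simp only [hγ', lapF]
        generalize (exp (2 * K * t) - 1) / K = c
        rw [mul_left_comm c, mul_left_comm (2 * u t x), ← mul_add, ← mul_add]
        congr 1
        rw [Finset.mul_sum, Finset.mul_sum, ← Finset.sum_add_distrib, ← Finset.sum_add_distrib]
        refine Finset.sum_congr rfl fun y _ => ?_
        ring
      rw [hlin]
      have hcd := hCD (u t) x
      rw [gam2Op] at hcd
      have hpos : 0 ≤ (exp (2 * K * t) - 1) / K := by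
        have : 1 ≤ exp (2 * K * t) := one_le_exp (by positivity)
        exact div_nonneg (by linarith) hK.le
      have he : exp (2 * K * t) = K * ((exp (2 * K * t) - 1) / K) + 1 := by field_simp; ring
      generalize (exp (2 * K * t) - 1) / K = c at *
      rw [he]
      nlinarith [mul_le_mul_of_nonneg_left hcd hpos])
    (fun x => by simpa using h0 x)
  intro t ht x
  have := key t ht x
  nlinarith [sq_nonneg (u t x)]

lemma edge_bound {V : Type*} [Fintype V] (m : V → ℝ) (ω : V → V → ℝ)
    (hm : ∀ x, 0 < m x) (hnn : ∀ x y, 0 ≤ ω x y)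
    (Dω : ℝ) (hD : 0 < Dω) (hDω : ∀ x y, ω x y ≠ 0 → m x ≤ Dω * ω x y)
    (u : V → ℝ) (c : ℝ) (hc : 0 < c) (x y : V) (hxy : ω x y ≠ 0)
    (h : c * gamOp m ω u u x ≤ 1) : |u x - u y| ≤ √(2 * Dω) / √c := by
  have hw : 0 < ω x y := lt_of_le_of_ne (hnn x y) (Ne.symm hxy)
  have hmx := hm x
  have h1 : ω x y * (u y - u x) * (u y - u x) ≤ ∑ z, ω x z * (u z - u x) * (u z - u x) :=
    Finset.single_le_sum (f := fun z => ω x z * (u z - u x) * (u z - u x))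
      (fun z _ => by nlinarith [mul_nonneg (hnn x z) (sq_nonneg (u z - u x))]) (Finset.mem_univ y)
  rw [gamF] at h
  have h2 : c * ∑ z, ω x z * (u z - u x) * (u z - u x) ≤ 2 * m x := by
    have : c * (1 / (2 * m x) * ∑ z, ω x z * (u z - u x) * (u z - u x))
      = (c * ∑ z, ω x z * (u z - u x) * (u z - u x)) / (2 * m x) := by ring
    rw [this, div_le_one (by positivity)] at h
    exact h
  have h3 : c * (ω x y * (u y - u x) * (u y - u x)) ≤ 2 * (Dω * ω x y) := by
    have := mul_le_mul_of_nonneg_left h1 hc.le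
    have := hDω x y hxy
    linarith
  have h4 : c * (u x - u y) ^ 2 ≤ 2 * Dω := by
    refine le_of_mul_le_mul_left ?_ hw
    nlinarith
  rw [← Real.sqrt_div (by positivity)]
  apply Real.abs_le_sqrt
  rw [le_div_iff₀ hc]; linarith

lemma hasDerivAt_Psi (K : ℝ) (hK : 0 < K) (t : ℝ) (ht : 0 < t) :
    HasDerivAt (fun s => (1 / √K) * arctan (√(exp (2 * K * s) - 1)))
      (1 / √((exp (2 * K * t) - 1) / K)) t := by
  have hgt : 0 < exp (2 * K * t) - 1 := by
    have : 1 < exp (2 * K * t) := one_lt_exp_iff.2 (by positivity)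
    linarith
  have h1 : HasDerivAt (fun s : ℝ => 2 * K * s) (2 * K) t := by
    simpa using (hasDerivAt_id t).const_mul (2 * K)
  have h2 := (((h1.exp.sub_const 1).sqrt hgt.ne').arctan).const_mul (1 / √K)
  refine h2.congr_deriv ?_
  rw [Real.sq_sqrt hgt.le, Real.sqrt_div hgt.le]
  have hs := Real.sqrt_pos.2 hgt
  have hk := Real.sqrt_pos.2 hK
  have hkk : √K ^ 2 = K := Real.sq_sqrt hK.le
  have he := exp_pos (2 * K * t)
  have : 1 + (exp (2 * K * t) - 1) = exp (2 * K * t) := by ring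
  rw [this]
  field_simp
  linarith

/-- lower bound on the Cheeger constant in terms of curvature. -/
theorem cheeger_lower_bound {V : Type*} [Fintype V] [DecidableEq V] [Nonempty V]
    (m : V → ℝ) (ω : V → V → ℝ)
    (hm : ∀ x, 0 < m x) (hnn : ∀ x y, 0 ≤ ω x y) (hsymm : ∀ x y, ω x y = ω y x)
    (hconn : ∀ x y : V, Relation.ReflTransGen (fun a b => 0 < ω a b) x y)
    (K Dω : ℝ) (hK : 0 < K) (hDω : ∀ x y, ω x y ≠ 0 → m x ≤ Dω * ω x y)
    (hCD : ∀ (f : V → ℝ) (x : V), gam2Op m ω f x ≥ K * gamOp m ω f f x) :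
    ∀ U : Finset V, U.Nonempty → U ≠ Finset.univ →
      (∑ x ∈ U, ∑ y ∈ Uᶜ, ω x y) / min (∑ x ∈ U, m x) (∑ x ∈ Uᶜ, m x)
        ≥ Real.sqrt K / (2 * Real.pi * Real.sqrt (2 * Dω)) := by
  classical
  intro U hU hUne
  set B := ∑ x ∈ U, ∑ y ∈ Uᶜ, ω x y with hB
  set a := ∑ x ∈ U, m x with ha
  set b := ∑ x ∈ Uᶜ, m x with hb
  have hB0 : 0 ≤ B := Finset.sum_nonneg fun x _ => Finset.sum_nonneg fun y _ => hnn x y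
  have ha0 : 0 < a := Finset.sum_pos (fun x _ => hm x) hU
  have hUc : Uᶜ.Nonempty := by
    rw [Finset.nonempty_iff_ne_empty]
    intro h
    exact hUne (Finset.compl_eq_empty_iff U |>.1 h)
  have hb0 : 0 < b := Finset.sum_pos (fun x _ => hm x) hUc
  have hmin : 0 < min a b := lt_min ha0 hb0
  rcases le_or_gt Dω 0 with hD | hD
  · rw [Real.sqrt_eq_zero_of_nonpos (by linarith : 2 * Dω ≤ 0)]
    simp only [mul_zero, div_zero]
    positivity
  obtain ⟨u, hu0, hu⟩ := heat_exists m ω (fun x => if x ∈ U then (1 : ℝ) else -1)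
  have hgrad := grad_bound m ω hm hnn hsymm K hK hCD u
    (fun x => by rw [hu0]; dsimp only; split_ifs <;> norm_num) hu
  have hcpos : ∀ t : ℝ, 0 < t → 0 < (exp (2 * K * t) - 1) / K := by
    intro t ht
    have : 1 < exp (2 * K * t) := one_lt_exp_iff.2 (by positivity)
    exact div_pos (by linarith) hK
  have hedge : ∀ t : ℝ, 0 < t → ∀ x y, ω x y ≠ 0 →
      |u t x - u t y| ≤ √(2 * Dω) / √((exp (2 * K * t) - 1) / K) := fun t ht x y hxy =>
    edge_bound m ω hm hnn Dω hD hDω (u t) _ (hcpos t ht) x y hxy (hgrad t ht.le x)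
  -- mass on a set
  have hmass : ∀ (s : Finset V) (t : ℝ), HasDerivAt (fun r => ∑ x ∈ s, m x * u r x)
      (∑ x ∈ s, ∑ y, ω x y * (u t y - u t x)) t := by
    intro s t
    refine (HasDerivAt.fun_sum fun x _ => (hu t x).const_mul (m x)).congr_deriv ?_
    refine Finset.sum_congr rfl fun x _ => ?_
    have := (hm x).ne'
    rw [lapF]; field_simp
  have htot : ∀ t, ∑ x, m x * u t x = a - b := by
    intro t
    have hc : ∑ x, m x * u t x = ∑ x, m x * u 0 x := by
      refine is_const_of_deriv_eq_zero (f := fun r => ∑ x, m x * u r x)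
        (fun r => (hmass _ r).differentiableAt) (fun r => ?_) t 0
      rw [(hmass _ r).deriv]
      exact antisymm_sum ω hsymm (u r) Finset.univ
    rw [hc, ← Finset.sum_add_sum_compl U, hu0, ha, hb, sub_eq_add_neg, ← Finset.sum_neg_distrib]
    congr 1
    · refine Finset.sum_congr rfl fun x hx => ?_
      simp [hx]
    · refine Finset.sum_congr rfl fun x hx => ?_
      simp [Finset.mem_compl.1 hx]
  -- the lower bound for the mass on U
  have hlow : ∀ t : ℝ, 0 ≤ t →
      a - B * √(2 * Dω) * (π / (2 * √K)) ≤ ∑ x ∈ U, m x * u t x := by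
    intro t ht
    have hmono : MonotoneOn (fun r => (∑ x ∈ U, m x * u r x)
        + B * √(2 * Dω) * ((1 / √K) * arctan (√(exp (2 * K * r) - 1)))) (Set.Ici 0) := by
      have hd : ∀ r : ℝ, 0 < r → HasDerivAt (fun r => (∑ x ∈ U, m x * u r x)
        + B * √(2 * Dω) * ((1 / √K) * arctan (√(exp (2 * K * r) - 1)))) _ r := fun r hr =>
        (hmass U r).add ((hasDerivAt_Psi K hK r hr).const_mul (B * √(2 * Dω)))
      have hcont : Continuous fun r => ∑ x ∈ U, m x * u r x :=
        continuous_iff_continuousAt.2 fun r => (hmass U r).continuousAt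
      refine monotoneOn_of_deriv_nonneg (convex_Ici 0) ?_ ?_ ?_
      · refine Continuous.continuousOn ?_
        refine hcont.add (Continuous.mul continuous_const (Continuous.mul continuous_const ?_))
        exact Real.continuous_arctan.comp (by fun_prop)
      · intro r hr
        rw [interior_Ici] at hr
        exact (hd r hr).differentiableAt.differentiableWithinAt
      · intro r hr
        rw [interior_Ici] at hr
        rw [(hd r hr).deriv]
        have e1 : ∑ x ∈ U, ∑ y, ω x y * (u r y - u r x)
            = ∑ x ∈ U, ∑ y ∈ Uᶜ, ω x y * (u r y - u r x) := by
          have : ∀ x, ∑ y, ω x y * (u r y - u r x) = ∑ y ∈ U, ω x y * (u r y - u r x)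
              + ∑ y ∈ Uᶜ, ω x y * (u r y - u r x) := fun x =>
            (Finset.sum_add_sum_compl U _).symm
          simp only [this]
          rw [Finset.sum_add_distrib, antisymm_sum ω hsymm (u r) U, zero_add]
        rw [e1, mul_assoc, hB, Finset.sum_mul, ← Finset.sum_add_distrib]
        refine Finset.sum_nonneg fun x _ => ?_
        rw [Finset.sum_mul, ← Finset.sum_add_distrib]
        refine Finset.sum_nonneg fun y _ => ?_
        rw [← mul_add]
        by_cases hxy : ω x y = 0
        · simp [hxy]
        · refine mul_nonneg (hnn x y) ?_
          have h1 := hedge r hr x y hxy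
          have h2 := le_abs_self (u r x - u r y)
          rw [mul_one_div]
          linarith
    have h1 := hmono (Set.mem_Ici.2 le_rfl) (Set.mem_Ici.2 ht) ht
    have h0 : ∑ x ∈ U, m x * u 0 x = a := by
      rw [hu0]
      refine Finset.sum_congr rfl fun x hx => ?_
      simp [hx]
    simp only [h0, mul_zero, exp_zero, sub_self, Real.sqrt_zero, arctan_zero, add_zero] at h1
    have h2 : (1 / √K) * arctan (√(exp (2 * K * t) - 1)) ≤ π / (2 * √K) := by
      have : arctan (√(exp (2 * K * t) - 1)) ≤ π / 2 := (arctan_lt_pi_div_two _).le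
      calc _ ≤ (1 / √K) * (π / 2) := by gcongr
        _ = _ := by field_simp
    have h3 : B * √(2 * Dω) * ((1 / √K) * arctan (√(exp (2 * K * t) - 1)))
      ≤ B * √(2 * Dω) * (π / (2 * √K)) := by gcongr
    linarith
  -- oscillation tends to zero
  have hlim0 : Tendsto (fun t : ℝ => √(2 * Dω) / √((exp (2 * K * t) - 1) / K)) atTop (𝓝 0) := by
    refine Tendsto.div_atTop tendsto_const_nhds ?_
    refine Real.tendsto_sqrt_atTop.comp ?_
    refine Tendsto.atTop_div_const hK ?_
    refine tendsto_atTop_add_const_right _ _ ?_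
    exact tendsto_exp_atTop.comp (tendsto_id.const_mul_atTop (by positivity))
  have hosc : ∀ x y, Tendsto (fun t => u t x - u t y) atTop (𝓝 0) := by
    intro x y
    induction hconn x y with
    | refl => simp
    | @tail p q _ hpq ih =>
      have h1 : Tendsto (fun t => u t p - u t q) atTop (𝓝 0) := by
        refine squeeze_zero_norm' ?_ hlim0
        filter_upwards [eventually_gt_atTop 0] with t ht
        exact hedge t ht p q hpq.ne'
      simpa using ih.add h1
  have hlim : Tendsto (fun t => (a + b) * (∑ x ∈ U, m x * u t x) - a * (a - b)) atTop (𝓝 0) := by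
    have h1 : Tendsto (fun t => ∑ x ∈ U, ∑ y, m x * m y * (u t x - u t y)) atTop (𝓝 0) := by
      have := tendsto_finsetSum U fun x _ => tendsto_finsetSum Finset.univ fun y _ =>
        (hosc x y).const_mul (m x * m y)
      simpa using this
    refine h1.congr fun t => ?_
    rw [← htot t, ha, hb, Finset.sum_add_sum_compl]
    simp only [mul_sub, Finset.sum_sub_distrib]
    congr 1
    · rw [mul_comm, Finset.sum_mul_sum]
      exact Finset.sum_congr rfl fun x _ => Finset.sum_congr rfl fun y _ => by ring
    · rw [Finset.sum_mul_sum]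
      exact Finset.sum_congr rfl fun x _ => Finset.sum_congr rfl fun y _ => by ring
  set c := B * √(2 * Dω) * (π / (2 * √K)) with hc
  have hfin : (a + b) * (a - c) - a * (a - b) ≤ 0 := by
    refine ge_of_tendsto hlim ?_
    filter_upwards [eventually_ge_atTop 0] with t ht
    have := mul_le_mul_of_nonneg_left (hlow t ht) (add_pos ha0 hb0).le
    linarith
  have hmc : min a b ≤ c := by
    refine le_of_mul_le_mul_left (a := a + b) ?_ (add_pos ha0 hb0)
    rcases min_cases a b with ⟨h, h'⟩ | ⟨h, h'⟩ <;> rw [h] <;> nlinarith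
  have hk := Real.sqrt_pos.2 hK
  have hd := Real.sqrt_pos.2 (by positivity : 0 < 2 * Dω)
  have hpi := Real.pi_pos
  rw [ge_iff_le, div_le_div_iff₀ (by positivity) hmin]
  have h1 : √K * c = B * (√(2 * Dω) * π) / 2 := by rw [hc]; field_simp
  have h2 : √K * min a b ≤ √K * c := by gcongr
  have h3 : 0 ≤ B * (√(2 * Dω) * π) := by positivity
  nlinarith
end
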